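/- arXiv:1903.08280 — 6 statements merged into one kernel-verified Lean document; each statement's English description precedes it below -/
import Mathlib

section
/- Let π be any containment-compatible processing order of the family R. Then A^π(R) is a 3-approximation of n·H(R); precisely, n·H(R) ≤ 3·A^π(R) and A^π(R) ≤ 2·n·H(R). -/
open scoped Classical

/-- The open interval family member `i` is `Set.Ioo (l i) (r i)`.
The contact set of `R_i` under the (identity) processing order:
indices `j ≤ i` whose interval intersects `R_i`. -/
noncomputable def contact (n : ℕ) (l r : Fin n → ℝ) (i : Fin n) : Finset (Fin n) :=
  Finset.univ.filter
    (fun j : Fin n => j ≤ i ∧ (Set.Ioo (l j) (r j) ∩ Set.Ioo (l i) (r i)).Nonempty)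

/-- The π-ambiguity of the family (already relabeled in processing order). -/
noncomputable def piAmbiguity (n : ℕ) (l r : Fin n → ℝ) : ℝ :=
  ∑ i : Fin n, Real.logb 2 ((contact n l r i).card : ℝ)

/-- A processing order (given as the relabeled family) is containment-compatible if
whenever `R_i ⊂ R_j` (proper subset) then `i < j`. -/
def ContainmentCompatible (n : ℕ) (l r : Fin n → ℝ) : Prop :=
  ∀ i j : Fin n, Set.Ioo (l i) (r i) ⊂ Set.Ioo (l j) (r j) → i < j

/-- The ambiguity: the minimum of the π-ambiguity over all processing orders. -/
noncomputable def ambiguity (n : ℕ) (l r : Fin n → ℝ) : ℝ :=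
  ⨅ π : Equiv.Perm (Fin n), piAmbiguity n (l ∘ π) (r ∘ π)

/-- Combinatorial equivalence of two indexed families of nonempty bounded open
intervals: `R_i` lies entirely to the left of `R_j` iff `I_i` lies entirely to
the left of `I_j`. -/
def CombEquiv {ι : Type*} (l r l' r' : ι → ℝ) : Prop :=
  ∀ i j : ι, (r i ≤ l j ↔ r' i ≤ l' j)

/-- `intervalE l r lam = E(R, λ)`: the supremum of `∑ log₂ |I_i|` over families of
open subintervals of `(0, λ)` combinatorially equivalent to `R`. -/
noncomputable def intervalE {ι : Type*} [Fintype ι] (l r : ι → ℝ) (lam : ℝ) : ℝ :=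
  sSup { x : ℝ | ∃ l' r' : ι → ℝ,
    (∀ i, 0 ≤ l' i ∧ l' i < r' i ∧ r' i ≤ lam) ∧
    CombEquiv l r l' r' ∧ x = ∑ i, Real.logb 2 (r' i - l' i) }

/-- The interval entropy `H(R) = E(R, n)/n`. -/
noncomputable def intervalEntropy (n : ℕ) (l r : Fin n → ℝ) : ℝ :=
  intervalE l r (n : ℝ) / (n : ℝ)

/-- The number of linear extensions of the interval order induced by `R`
(`i ≺ j` iff `r i ≤ l j`), counted via ranking permutations. -/
noncomputable def numLinExt (n : ℕ) (l r : Fin n → ℝ) : ℕ :=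
  Fintype.card {σ : Equiv.Perm (Fin n) // ∀ i j : Fin n, r i ≤ l j → σ i < σ j}

theorem Ioo_inter_Ioo_nonempty_iff {a b c d : ℝ} (hab : a < b) (hcd : c < d) :
    (Set.Ioo a b ∩ Set.Ioo c d).Nonempty ↔ a < d ∧ c < b := by
  rw [Set.Ioo_inter_Ioo, Set.nonempty_Ioo, max_lt_iff, lt_min_iff, lt_min_iff]
  tauto

theorem mem_contact_iff {n : ℕ} {l r : Fin n → ℝ} (hlr : ∀ i, l i < r i) {i j : Fin n} :
    j ∈ contact n l r i ↔ j ≤ i ∧ l j < r i ∧ l i < r j := by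
  simp [contact, Ioo_inter_Ioo_nonempty_iff (hlr j) (hlr i)]

theorem self_mem_contact {n : ℕ} {l r : Fin n → ℝ} (hlr : ∀ i, l i < r i) (i : Fin n) :
    i ∈ contact n l r i := by
  simp [mem_contact_iff hlr, hlr i]

theorem one_le_card_contact {n : ℕ} {l r : Fin n → ℝ} (hlr : ∀ i, l i < r i) (i : Fin n) :
    1 ≤ (contact n l r i).card :=
  Finset.card_pos.2 ⟨i, self_mem_contact hlr i⟩

/-- The intersection pattern, hence the contact sets, only depends on the combinatorial type. -/
theorem CombEquiv.contact_eq {n : ℕ} {l r l' r' : Fin n → ℝ} (h : CombEquiv l r l' r')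
    (hlr : ∀ i, l i < r i) (hlr' : ∀ i, l' i < r' i) (i : Fin n) :
    contact n l' r' i = contact n l r i := by
  ext j
  rw [mem_contact_iff hlr, mem_contact_iff hlr', ← not_le, ← not_le, ← h i j, ← h j i,
    not_le, not_le]

theorem intervalE_comp_perm {ι : Type*} [Fintype ι] (l r : ι → ℝ) (lam : ℝ)
    (π : Equiv.Perm ι) : intervalE (l ∘ π) (r ∘ π) lam = intervalE l r lam := by
  unfold intervalE
  congr 1
  ext x
  constructor
  · rintro ⟨l', r', hb, hc, rfl⟩
    refine ⟨l' ∘ π.symm, r' ∘ π.symm, fun i => hb _, fun i j => ?_, ?_⟩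
    · simpa using hc (π.symm i) (π.symm j)
    · exact (Equiv.sum_comp π.symm fun i => Real.logb 2 (r' i - l' i)).symm
  · rintro ⟨l', r', hb, hc, rfl⟩
    exact ⟨l' ∘ π, r' ∘ π, fun i => hb _, fun i j => hc _ _,
      (Equiv.sum_comp π fun i => Real.logb 2 (r' i - l' i)).symm⟩

/-- Among independent events of probabilities `f i`, at most one is the last to occur. -/
theorem sum_mul_prod_one_sub_le_one {ι : Type*} [LinearOrder ι] (f : ι → ℝ)
    (hf1 : ∀ i, f i ≤ 1) (s : Finset ι) :
    ∑ i ∈ s, f i * ∏ j ∈ s with i < j, (1 - f j) ≤ 1 := by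
  have hnn : 0 ≤ ∏ i ∈ s, (1 - f i) :=
    Finset.prod_nonneg fun i _ => sub_nonneg.2 (hf1 i)
  have h : ∑ i ∈ s, f i * ∏ j ∈ s with i < j, (1 - f j) = 1 - ∏ i ∈ s, (1 - f i) := by
    clear hnn
    induction s using Finset.induction_on_min with
    | empty => simp
    | insert a s ha ih =>
      have has : a ∉ s := fun h => (ha a h).false
      have hhead : (insert a s).filter (a < ·) = s := by
        rw [Finset.filter_insert, if_neg (lt_irrefl a), Finset.filter_true_of_mem ha]
      have htail : ∀ i ∈ s, (insert a s).filter (i < ·) = s.filter (i < ·) := fun i hi => by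
        rw [Finset.filter_insert, if_neg (ha i hi).not_gt]
      rw [Finset.sum_insert has, Finset.prod_insert has, hhead,
        Finset.sum_congr rfl fun i hi => by rw [htail i hi], ih]
      ring
  linarith

/-- Fractional packing: if the weights of the intervals covering any point add up to at most one,
then the weighted total length of intervals inside `(0, lam)` is at most `lam`. -/
theorem sum_mul_length_le {ι : Type*} [Fintype ι] {l r a : ι → ℝ} {lam : ℝ} (hlam : 0 ≤ lam)
    (h : ∀ i, 0 ≤ l i ∧ l i < r i ∧ r i ≤ lam)
    (ha : ∀ x : ℝ, ∑ i with x ∈ Set.Ioo (l i) (r i), a i ≤ 1) :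
    ∑ i, a i * (r i - l i) ≤ lam := by
  have hint : ∀ i, MeasureTheory.IntegrableOn
      ((Set.Ioo (l i) (r i)).indicator fun _ => a i) (Set.Ioo 0 lam) := fun i =>
    (MeasureTheory.integrableOn_const (by simp)).indicator measurableSet_Ioo
  have hval : ∀ i, ∫ x in Set.Ioo 0 lam, (Set.Ioo (l i) (r i)).indicator (fun _ => a i) x
      = a i * (r i - l i) := by
    intro i
    have hsub : Set.Ioo 0 lam ∩ Set.Ioo (l i) (r i) = Set.Ioo (l i) (r i) :=
      Set.inter_eq_right.2 (Set.Ioo_subset_Ioo (h i).1 (h i).2.2)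
    rw [MeasureTheory.setIntegral_indicator measurableSet_Ioo, hsub,
      MeasureTheory.setIntegral_const, Real.volume_real_Ioo_of_le (h i).2.1.le, smul_eq_mul,
      mul_comm]
  calc ∑ i, a i * (r i - l i)
      = ∫ x in Set.Ioo 0 lam, ∑ i, (Set.Ioo (l i) (r i)).indicator (fun _ => a i) x := by
        rw [MeasureTheory.integral_finsetSum _ fun i _ => hint i]
        exact Finset.sum_congr rfl fun i _ => (hval i).symm
    _ ≤ ∫ _ in Set.Ioo 0 lam, (1 : ℝ) := by
        refine MeasureTheory.setIntegral_mono
          (MeasureTheory.integrable_finsetSum _ fun i _ => hint i)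
          (MeasureTheory.integrableOn_const (by simp)) fun x => ?_
        simpa [Set.indicator_apply, Finset.sum_filter] using ha x
    _ = lam := by simp [hlam]

theorem neg_two_mul_log_le (k : ℕ) (hk : 1 ≤ k) :
    -(2 * Real.log k) ≤ ((k : ℝ) - 1) * Real.log (1 - 1 / k) := by
  obtain rfl | hk2 := hk.eq_or_lt
  · simp
  have hk2' : (2 : ℝ) ≤ k := by exact_mod_cast hk2
  have hlogk : Real.log 2 ≤ Real.log k := Real.log_le_log two_pos hk2'
  have h2 := Real.log_two_gt_d9
  have hpos : (0 : ℝ) < 1 - 1 / k := by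
    rw [sub_pos, div_lt_one (by linarith)]
    linarith
  have h1 := Real.one_sub_inv_le_log_of_pos hpos
  have h3 : ((k : ℝ) - 1) * (1 - (1 - 1 / (k : ℝ))⁻¹) = -1 := by
    have : (k : ℝ) - 1 ≠ 0 := by linarith
    field_simp
    ring
  have h4 := mul_le_mul_of_nonneg_left h1 (show (0 : ℝ) ≤ (k : ℝ) - 1 by linarith)
  linarith

/-- The probability that `i` is selected when every `j` is marked independently with probability
`1 / |Γ_j|`, and `i` is selected if it is marked and no later interval meeting it is marked. -/
noncomputable def selectionWeight (n : ℕ) (l r : Fin n → ℝ) (i : Fin n) : ℝ :=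
  1 / ((contact n l r i).card : ℝ) *
    ∏ j with i < j ∧ i ∈ contact n l r j, (1 - 1 / ((contact n l r j).card : ℝ))

section Selection

variable {n : ℕ} {l r : Fin n → ℝ}

theorem one_div_card_contact_le_one (hlr : ∀ i, l i < r i) (i : Fin n) :
    1 / ((contact n l r i).card : ℝ) ≤ 1 := by
  have : (1 : ℝ) ≤ (contact n l r i).card := by exact_mod_cast one_le_card_contact hlr i
  rw [div_le_one (by linarith)]
  exact this

theorem one_sub_one_div_card_contact_pos (hlr : ∀ i, l i < r i) {i j : Fin n} (hij : i < j)
    (h : i ∈ contact n l r j) : 0 < 1 - 1 / ((contact n l r j).card : ℝ) := by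
  have hc : 1 < (contact n l r j).card :=
    Finset.one_lt_card.2 ⟨i, h, j, self_mem_contact hlr j, hij.ne⟩
  have hc' : (1 : ℝ) < (contact n l r j).card := by exact_mod_cast hc
  rw [sub_pos, div_lt_one (by linarith)]
  exact hc'

theorem selectionWeight_pos (hlr : ∀ i, l i < r i) (i : Fin n) :
    0 < selectionWeight n l r i := by
  have : (0 : ℝ) < (contact n l r i).card := by exact_mod_cast one_le_card_contact hlr i
  refine mul_pos (by positivity) (Finset.prod_pos fun j hj => ?_)
  obtain ⟨hij, h⟩ := (Finset.mem_filter.1 hj).2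
  exact one_sub_one_div_card_contact_pos hlr hij h

theorem sum_selectionWeight_le_one (hlr : ∀ i, l i < r i) (x : ℝ) :
    ∑ i with x ∈ Set.Ioo (l i) (r i), selectionWeight n l r i ≤ 1 := by
  refine le_trans (Finset.sum_le_sum fun i hi => ?_)
    (sum_mul_prod_one_sub_le_one (fun i => 1 / ((contact n l r i).card : ℝ))
      (one_div_card_contact_le_one hlr) _)
  refine mul_le_mul_of_nonneg_left ?_ (by positivity)
  have hi' := (Finset.mem_filter.1 hi).2
  refine Finset.prod_le_prod_of_subset_of_le_one ?_ ?_ ?_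
  · intro j hj
    simp only [Finset.mem_filter, Finset.mem_univ, true_and] at hj ⊢
    exact ⟨hj.2, (mem_contact_iff hlr).2
      ⟨hj.2.le, hi'.1.trans hj.1.2, hj.1.1.trans hi'.2⟩⟩
  · exact fun j _ => sub_nonneg.2 (one_div_card_contact_le_one hlr j)
  · exact fun j _ _ => sub_le_self _ (by positivity)

theorem neg_three_mul_sum_log_le (hlr : ∀ i, l i < r i) :
    -(3 * ∑ i, Real.log ((contact n l r i).card : ℝ)) ≤
      ∑ i, Real.log (selectionWeight n l r i) := by
  have hlog : ∀ i, Real.log (selectionWeight n l r i) =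
      -Real.log ((contact n l r i).card : ℝ) +
        ∑ j with i < j ∧ i ∈ contact n l r j,
          Real.log (1 - 1 / ((contact n l r j).card : ℝ)) := by
    intro i
    have hc : ((contact n l r i).card : ℝ) ≠ 0 := by
      exact_mod_cast Nat.one_le_iff_ne_zero.1 (one_le_card_contact hlr i)
    have hp : ∀ j ∈ Finset.univ.filter fun j => i < j ∧ i ∈ contact n l r j,
        1 - 1 / ((contact n l r j).card : ℝ) ≠ 0 := fun j hj => by
      obtain ⟨hij, h⟩ := (Finset.mem_filter.1 hj).2
      exact (one_sub_one_div_card_contact_pos hlr hij h).ne'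
    rw [selectionWeight, Real.log_mul (one_div_ne_zero hc) (Finset.prod_ne_zero_iff.2 hp),
      Real.log_prod hp, one_div, Real.log_inv]
  have hswap : ∑ i, ∑ j with i < j ∧ i ∈ contact n l r j,
      Real.log (1 - 1 / ((contact n l r j).card : ℝ)) =
      ∑ j, (((contact n l r j).card : ℝ) - 1) *
        Real.log (1 - 1 / ((contact n l r j).card : ℝ)) := by
    rw [Finset.sum_comm' (s' := fun j => (contact n l r j).erase j) (t' := Finset.univ)]
    · refine Finset.sum_congr rfl fun j _ => ?_
      rw [Finset.sum_const, nsmul_eq_mul, Finset.card_erase_of_mem (self_mem_contact hlr j),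
        Nat.cast_sub (one_le_card_contact hlr j), Nat.cast_one]
    · intro i j
      simp only [Finset.mem_univ, Finset.mem_filter, true_and, Finset.mem_erase, and_true]
      constructor
      · exact fun h => ⟨h.1.ne, h.2⟩
      · exact fun h => ⟨lt_of_le_of_ne ((mem_contact_iff hlr).1 h.2).1 h.1, h.2⟩
  rw [Finset.sum_congr rfl fun i _ => hlog i, Finset.sum_add_distrib, hswap,
    Finset.sum_neg_distrib]
  have := Finset.sum_le_sum fun (j : Fin n) (_ : j ∈ Finset.univ) =>
    neg_two_mul_log_le _ (one_le_card_contact hlr j)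
  rw [Finset.sum_neg_distrib, ← Finset.mul_sum] at this
  linarith

/-- Every realization inside `(0, n)` has total log-length at most three times the ambiguity;
the processing order is arbitrary here. -/
theorem sum_logb_length_le (hlr : ∀ i, l i < r i) (hb : ∀ i, 0 ≤ l i ∧ r i ≤ n) :
    ∑ i, Real.logb 2 (r i - l i) ≤ 3 * piAmbiguity n l r := by
  have hpack := sum_mul_length_le (Nat.cast_nonneg n)
    (fun i => ⟨(hb i).1, hlr i, (hb i).2⟩) (sum_selectionWeight_le_one hlr)
  have hlog : ∑ i, Real.log (selectionWeight n l r i) + ∑ i, Real.log (r i - l i) ≤ 0 := by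
    rw [← Finset.sum_add_distrib]
    calc ∑ i, (Real.log (selectionWeight n l r i) + Real.log (r i - l i))
        ≤ ∑ i, (selectionWeight n l r i * (r i - l i) - 1) := by
          refine Finset.sum_le_sum fun i _ => ?_
          have ha := selectionWeight_pos hlr i
          have hd := sub_pos.2 (hlr i)
          rw [← Real.log_mul ha.ne' hd.ne']
          exact Real.log_le_sub_one_of_pos (mul_pos ha hd)
      _ ≤ 0 := by
          rw [Finset.sum_sub_distrib]
          simpa using hpack
  have hw := neg_three_mul_sum_log_le hlr
  simp only [piAmbiguity, Real.logb]
  rw [← Finset.sum_div, ← Finset.sum_div, ← mul_div_assoc]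
  gcongr
  linarith

end Selection

/-- Averaging the ranks of the left endpoints with those of the right endpoints gives a realization
inside `(0, n)` in which the `i`-th interval has length at least `(|Γ_i| + 1) / 2`. -/
theorem exists_realization {n : ℕ} {l r : Fin n → ℝ} (hlr : ∀ i, l i < r i)
    (hcc : ContainmentCompatible n l r) :
    ∃ l' r' : Fin n → ℝ, (∀ i, 0 ≤ l' i ∧ l' i < r' i ∧ r' i ≤ n) ∧ CombEquiv l r l' r' ∧
      ∀ i, (((contact n l r i).card : ℝ) + 1) / 2 ≤ r' i - l' i := by
  let cr : ℝ → Finset (Fin n) := fun x => Finset.univ.filter fun j => r j ≤ x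
  let cl : ℝ → Finset (Fin n) := fun x => Finset.univ.filter fun j => l j < x
  have hcr : ∀ {x y : ℝ}, x ≤ y → cr x ⊆ cr y := fun h =>
    Finset.monotone_filter_right _ fun j _ hj => le_trans hj h
  have hcl : ∀ {x y : ℝ}, x ≤ y → cl x ⊆ cl y := fun h =>
    Finset.monotone_filter_right _ fun j _ hj => lt_of_lt_of_le hj h
  let p : ℝ → ℝ := fun x => (((cr x).card : ℝ) + (cl x).card) / 2
  have hmono : Monotone p := fun x y h => by
    have h1 : ((cr x).card : ℝ) ≤ (cr y).card := by exact_mod_cast Finset.card_le_card (hcr h)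
    have h2 : ((cl x).card : ℝ) ≤ (cl y).card := by exact_mod_cast Finset.card_le_card (hcl h)
    simp only [p]
    linarith
  have hstrict : ∀ i j, l j < r i → p (l j) < p (r i) := fun i j h => by
    have h1 : ((cr (l j)).card : ℝ) ≤ (cr (r i)).card := by
      exact_mod_cast Finset.card_le_card (hcr h.le)
    have h2 : ((cl (l j)).card : ℝ) < (cl (r i)).card := by
      exact_mod_cast Finset.card_lt_card
        ((Finset.ssubset_iff_of_subset (hcl h.le)).2 ⟨j, by simp [cl, h], by simp [cl]⟩)
    simp only [p]
    linarith
  refine ⟨fun i => p (l i), fun i => p (r i), fun i => ⟨by positivity, hstrict i i (hlr i), ?_⟩,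
    fun i j => ⟨fun h => hmono h, fun h => ?_⟩, fun i => ?_⟩
  · have h1 : ((cr (r i)).card : ℝ) ≤ n := by exact_mod_cast card_finset_fin_le _
    have h2 : ((cl (r i)).card : ℝ) ≤ n := by exact_mod_cast card_finset_fin_le _
    simp only [p]
    linarith
  · by_contra! hlt
    exact (hstrict i j hlt).not_ge h
  · set A := cr (r i) \ cr (l i)
    set B := cl (r i) \ cl (l i)
    have hA : A.card + (cr (l i)).card = (cr (r i)).card :=
      Finset.card_sdiff_add_card_eq_card (hcr (hlr i).le)
    have hB : B.card + (cl (l i)).card = (cl (r i)).card :=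
      Finset.card_sdiff_add_card_eq_card (hcl (hlr i).le)
    have hunion : contact n l r i ⊆ A ∪ B := by
      intro j hj
      obtain ⟨hji, h1, h2⟩ := (mem_contact_iff hlr).1 hj
      simp only [A, B, cr, cl, Finset.mem_union, Finset.mem_sdiff, Finset.mem_filter,
        Finset.mem_univ, true_and, not_le, not_lt]
      by_contra! hcon
      have hr : r i < r j := by
        by_contra! h
        exact (hcon.1 h).not_gt h2
      have hl : l j < l i := hcon.2 h1
      have hlt : i < j := hcc i j <| by
        refine ⟨Set.Ioo_subset_Ioo hl.le hr.le, fun hsub => ?_⟩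
        exact hl.not_ge ((Set.Ioo_subset_Ioo_iff (hlr j)).1 hsub).1
      exact hlt.not_ge hji
    have hinter : 1 ≤ (A ∩ B).card :=
      Finset.card_pos.2 ⟨i, by simp [A, B, cr, cl, hlr i]⟩
    have hcard := Finset.card_le_card hunion
    have hui := Finset.card_union_add_card_inter A B
    have hfin : (contact n l r i).card + 1 + (cr (l i)).card + (cl (l i)).card ≤
        (cr (r i)).card + (cl (r i)).card := by omega
    have hfin' : ((contact n l r i).card : ℝ) + 1 + (cr (l i)).card + (cl (l i)).card ≤
        (cr (r i)).card + (cl (r i)).card := by exact_mod_cast hfin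
    simp only [p]
    linarith

theorem piAmbiguity_le_two_mul_sum {n : ℕ} {l r l' r' : Fin n → ℝ} (hlr : ∀ i, l i < r i)
    (h : ∀ i, (((contact n l r i).card : ℝ) + 1) / 2 ≤ r' i - l' i) :
    piAmbiguity n l r ≤ 2 * ∑ i, Real.logb 2 (r' i - l' i) := by
  rw [piAmbiguity, Finset.mul_sum]
  refine Finset.sum_le_sum fun i _ => ?_
  have hk : (1 : ℝ) ≤ (contact n l r i).card := by exact_mod_cast one_le_card_contact hlr i
  have hpow := Real.logb_pow 2 (r' i - l' i) 2
  rw [Nat.cast_ofNat] at hpow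
  rw [← hpow]
  refine Real.logb_le_logb_of_le one_lt_two (by linarith) ?_
  nlinarith [h i, sq_nonneg (((contact n l r i).card : ℝ) - 1)]

theorem intervalE_bounds {n : ℕ} {l r : Fin n → ℝ} (hlr : ∀ i, l i < r i)
    (hcc : ContainmentCompatible n l r) :
    intervalE l r n ≤ 3 * piAmbiguity n l r ∧ piAmbiguity n l r ≤ 2 * intervalE l r n := by
  obtain ⟨l', r', hb, hc, hlen⟩ := exists_realization hlr hcc
  have hub : 3 * piAmbiguity n l r ∈ upperBounds { x : ℝ | ∃ l' r' : Fin n → ℝ,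
      (∀ i, 0 ≤ l' i ∧ l' i < r' i ∧ r' i ≤ (n : ℝ)) ∧
      CombEquiv l r l' r' ∧ x = ∑ i, Real.logb 2 (r' i - l' i) } := by
    rintro x ⟨l₁, r₁, hb₁, hc₁, rfl⟩
    have hlr₁ : ∀ i, l₁ i < r₁ i := fun i => (hb₁ i).2.1
    have hA : piAmbiguity n l₁ r₁ = piAmbiguity n l r := by
      simp only [piAmbiguity, hc₁.contact_eq hlr hlr₁]
    rw [← hA]
    exact sum_logb_length_le hlr₁ fun i => ⟨(hb₁ i).1, (hb₁ i).2.2⟩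
  have hmem : ∑ i, Real.logb 2 (r' i - l' i) ≤ intervalE l r n :=
    le_csSup ⟨_, hub⟩ ⟨l', r', hb, hc, rfl⟩
  refine ⟨csSup_le ⟨_, l', r', hb, hc, rfl⟩ hub, ?_⟩
  exact (piAmbiguity_le_two_mul_sum hlr hlen).trans (by linarith)

theorem stmt0 (n : ℕ) (hn : 1 ≤ n) (l r : Fin n → ℝ) (hlr : ∀ i, l i < r i)
    (π : Equiv.Perm (Fin n))
    (hcc : ContainmentCompatible n (l ∘ π) (r ∘ π)) :
    (n : ℝ) * intervalEntropy n l r ≤ 3 * piAmbiguity n (l ∘ π) (r ∘ π) ∧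
    piAmbiguity n (l ∘ π) (r ∘ π) ≤ 2 * (n : ℝ) * intervalEntropy n l r := by
  have hn0 : (n : ℝ) ≠ 0 := by exact_mod_cast (Nat.one_le_iff_ne_zero.1 hn)
  have hE : (n : ℝ) * intervalEntropy n l r = intervalE (l ∘ π) (r ∘ π) n := by
    rw [intervalE_comp_perm, intervalEntropy, mul_div_cancel₀ _ hn0]
  rw [mul_assoc, hE]
  exact intervalE_bounds (fun i => hlr (π i)) hcc
end

section
/- For any containment-compatible processing order π of the family R, A^π(R) ≤ 2·n·H(R). -/
open scoped Classical

/-- Half the number of left endpoints before `x` plus half the number of right endpoints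
up to `x`: the monotone rescaling that gives mass `1/2` to each end of each interval. -/
noncomputable def endpointMass {n : ℕ} (l r : Fin n → ℝ) (x : ℝ) : ℝ :=
  (((Finset.univ.filter fun j => l j < x).card : ℝ) +
    ((Finset.univ.filter fun j => r j ≤ x).card : ℝ)) / 2

lemma endpointMass_nonneg {n : ℕ} (l r : Fin n → ℝ) (x : ℝ) : 0 ≤ endpointMass l r x := by
  unfold endpointMass
  positivity

lemma endpointMass_le {n : ℕ} (l r : Fin n → ℝ) (x : ℝ) : endpointMass l r x ≤ n := by
  have h (p : Fin n → Prop) : ((Finset.univ.filter p).card : ℝ) ≤ n := by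
    exact_mod_cast (Finset.card_filter_le _ _).trans (by simp)
  have h₁ := h fun j => l j < x
  have h₂ := h fun j => r j ≤ x
  unfold endpointMass
  linarith

lemma endpointMass_mono {n : ℕ} (l r : Fin n → ℝ) : Monotone (endpointMass l r) := by
  intro x y hxy
  unfold endpointMass
  gcongr

/-- Every index up to `i` in contact with `i` contributes an endpoint inside `R_i`, and `i`
itself contributes both of its endpoints. -/
lemma card_contact_add_one_le {n : ℕ} {l r : Fin n → ℝ} (hlr : ∀ i, l i < r i)
    (hcc : ContainmentCompatible n l r) (i : Fin n) :
    ((contact n l r i).card : ℝ) + 1 ≤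
      2 * (endpointMass l r (r i) - endpointMass l r (l i)) := by
  set A := Finset.univ.filter fun j => l i ≤ l j ∧ l j < r i
  set B := Finset.univ.filter fun j => l i < r j ∧ r j ≤ r i
  have hA : A.card + (Finset.univ.filter fun j => l j < l i).card =
      (Finset.univ.filter fun j => l j < r i).card := by
    rw [← Finset.card_union_of_disjoint]
    · congr 1
      ext j
      have := hlr i
      simp only [A, Finset.mem_union, Finset.mem_filter, Finset.mem_univ, true_and]
      grind
    · rw [Finset.disjoint_filter]
      intro j _ hj
      exact not_lt.mpr hj.1
  have hB : B.card + (Finset.univ.filter fun j => r j ≤ l i).card =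
      (Finset.univ.filter fun j => r j ≤ r i).card := by
    rw [← Finset.card_union_of_disjoint]
    · congr 1
      ext j
      have := hlr i
      simp only [B, Finset.mem_union, Finset.mem_filter, Finset.mem_univ, true_and]
      grind
    · rw [Finset.disjoint_filter]
      intro j _ hj
      exact not_le.mpr hj.1
  have hsub : contact n l r i ⊆ A ∪ B := by
    intro j hj
    simp only [contact, Finset.mem_filter, Finset.mem_univ, true_and] at hj
    obtain ⟨hji, x, hxj, hxi⟩ := hj
    have h : l i ≤ l j ∨ r j ≤ r i := by
      by_contra! h
      refine hji.not_gt (hcc i j ⟨Set.Ioo_subset_Ioo h.1.le h.2.le, fun hs => ?_⟩)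
      exact h.1.not_ge ((Set.Ioo_subset_Ioo_iff (hlr j)).mp hs).1
    have h₁ := hxj.1.trans hxi.2
    have h₂ := hxi.1.trans hxj.2
    simp only [A, B, Finset.mem_union, Finset.mem_filter, Finset.mem_univ, true_and]
    tauto
  have hinter : 1 ≤ (A ∩ B).card :=
    Finset.card_pos.mpr ⟨i, by simp [A, B, hlr i]⟩
  have hcard : (contact n l r i).card + 1 ≤ A.card + B.card := by
    have := Finset.card_le_card hsub
    have := Finset.card_union_add_card_inter A B
    omega
  unfold endpointMass
  rify at hA hB hcard
  linarith

lemma combEquiv_endpointMass {n : ℕ} (l r : Fin n → ℝ) :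
    CombEquiv l r (fun i => endpointMass l r (l i)) (fun i => endpointMass l r (r i)) := by
  intro i j
  refine ⟨fun h => endpointMass_mono l r h, fun h => ?_⟩
  by_contra! hij
  refine h.not_gt ?_
  have hlt : (Finset.univ.filter fun k => l k < l j).card <
      (Finset.univ.filter fun k => l k < r i).card := by
    refine Finset.card_lt_card (Finset.ssubset_iff_of_subset ?_ |>.mpr ⟨j, ?_, ?_⟩)
    · exact Finset.monotone_filter_right _ fun k _ hk => lt_trans hk hij
    · simpa using hij
    · simp
  have hle : (Finset.univ.filter fun k => r k ≤ l j).card ≤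
      (Finset.univ.filter fun k => r k ≤ r i).card := by
    gcongr
  unfold endpointMass
  rify at hlt hle
  linarith

lemma bddAbove_log_lengths {ι : Type*} [Fintype ι] (l r : ι → ℝ) (lam : ℝ) :
    BddAbove { x : ℝ | ∃ l' r' : ι → ℝ,
      (∀ i, 0 ≤ l' i ∧ l' i < r' i ∧ r' i ≤ lam) ∧
      CombEquiv l r l' r' ∧ x = ∑ i, Real.logb 2 (r' i - l' i) } := by
  refine ⟨∑ _i : ι, Real.logb 2 lam, ?_⟩
  rintro _ ⟨l', r', h, -, rfl⟩
  refine Finset.sum_le_sum fun i _ => ?_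
  obtain ⟨h₀, h₁, h₂⟩ := h i
  exact Real.logb_le_logb_of_le one_lt_two (by linarith) (by linarith)

lemma intervalE_comp_equiv {ι : Type*} [Fintype ι] (l r : ι → ℝ) (lam : ℝ)
    (e : Equiv.Perm ι) : intervalE (l ∘ e) (r ∘ e) lam = intervalE l r lam := by
  unfold intervalE
  congr 1
  ext x
  constructor
  · rintro ⟨l', r', h, hc, rfl⟩
    refine ⟨l' ∘ e.symm, r' ∘ e.symm, fun i => h _, fun i j => ?_, ?_⟩
    · simpa using hc (e.symm i) (e.symm j)
    · exact (Equiv.sum_comp e.symm fun i => Real.logb 2 (r' i - l' i)).symm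
  · rintro ⟨l', r', h, hc, rfl⟩
    exact ⟨l' ∘ e, r' ∘ e, fun i => h _, fun i j => hc _ _,
      (Equiv.sum_comp e fun i => Real.logb 2 (r' i - l' i)).symm⟩

lemma logb_le_two_mul_logb_of_add_one_le {k x : ℝ} (hk : 0 < k) (h : k + 1 ≤ 2 * x) :
    Real.logb 2 k ≤ 2 * Real.logb 2 x := by
  have hpow : 2 * Real.logb 2 x = Real.logb 2 (x ^ 2) := by
    rw [Real.logb_pow]
    norm_num
  rw [hpow]
  exact Real.logb_le_logb_of_le one_lt_two hk (by nlinarith [sq_nonneg (k - 1)])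

lemma piAmbiguity_le_two_mul_intervalE {n : ℕ} {l r : Fin n → ℝ} (hlr : ∀ i, l i < r i)
    (hcc : ContainmentCompatible n l r) :
    piAmbiguity n l r ≤ 2 * intervalE l r n := by
  have hcard := card_contact_add_one_le hlr hcc
  have hE : ∑ i, Real.logb 2 (endpointMass l r (r i) - endpointMass l r (l i)) ≤
      intervalE l r n := by
    refine le_csSup (bddAbove_log_lengths l r n)
      ⟨_, _, fun i => ⟨endpointMass_nonneg l r _, ?_, endpointMass_le l r _⟩,
        combEquiv_endpointMass l r, rfl⟩
    have := hcard i
    have : (0 : ℝ) ≤ (contact n l r i).card := Nat.cast_nonneg _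
    linarith
  refine le_trans ?_ (mul_le_mul_of_nonneg_left hE zero_le_two)
  rw [Finset.mul_sum]
  refine Finset.sum_le_sum fun i _ => logb_le_two_mul_logb_of_add_one_le ?_ (hcard i)
  exact_mod_cast Finset.card_pos.mpr ⟨i, by simp [contact, hlr i]⟩

theorem stmt2 (n : ℕ) (hn : 1 ≤ n) (l r : Fin n → ℝ) (hlr : ∀ i, l i < r i)
    (π : Equiv.Perm (Fin n))
    (hcc : ContainmentCompatible n (l ∘ π) (r ∘ π)) :
    piAmbiguity n (l ∘ π) (r ∘ π) ≤ 2 * (n : ℝ) * intervalEntropy n l r := by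
  have hn' : (n : ℝ) ≠ 0 := by positivity
  have h := piAmbiguity_le_two_mul_intervalE (l := l ∘ π) (r := r ∘ π) (fun i => hlr (π i)) hcc
  rw [intervalE_comp_equiv] at h
  rw [intervalEntropy, mul_assoc, mul_div_cancel₀ _ hn']
  exact h
end

section
/- Suppose the index set {1,…,n} is partitioned into two nonempty sets A and B such that R_a ∩ R_b = ∅ for every a ∈ A and b ∈ B. Then E(R, n) = sup over λ with 0 < λ < n of ( E(R_A, λ) + E(R_B, n − λ) ), where R_A and R_B denote the subfamilies of R indexed by A and B. -/
open scoped Classical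

open MeasureTheory

/-- The set of total log-lengths whose supremum is `intervalE`. -/
def intervalESet {ι : Type*} [Fintype ι] (l r : ι → ℝ) (lam : ℝ) : Set ℝ :=
  { x : ℝ | ∃ l' r' : ι → ℝ,
    (∀ i, 0 ≤ l' i ∧ l' i < r' i ∧ r' i ≤ lam) ∧
    CombEquiv l r l' r' ∧ x = ∑ i, Real.logb 2 (r' i - l' i) }

theorem bddAbove_intervalESet {ι : Type*} [Fintype ι] (l r : ι → ℝ) (lam : ℝ) :
    BddAbove (intervalESet l r lam) := by
  refine ⟨∑ _i : ι, Real.logb 2 lam, ?_⟩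
  rintro x ⟨l', r', h, -, rfl⟩
  refine Finset.sum_le_sum fun i _ => ?_
  obtain ⟨h0, h1, h2⟩ := h i
  exact Real.logb_le_logb_of_le (by norm_num) (by linarith) (by linarith)

theorem intervalESet_nonempty {ι : Type*} [Fintype ι] {l r : ι → ℝ} (hlr : ∀ i, l i < r i)
    {lam : ℝ} (hlam : 0 < lam) : (intervalESet l r lam).Nonempty := by
  obtain ⟨K, hK, hl, hr⟩ : ∃ K : ℝ, 0 < K ∧ (∀ i, -K ≤ l i) ∧ ∀ i, r i ≤ K := by
    have hle : ∀ i, |l i| + |r i| ≤ ∑ j, (|l j| + |r j|) := fun i =>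
      Finset.single_le_sum (f := fun j => |l j| + |r j|) (fun j _ => by positivity)
        (Finset.mem_univ i)
    refine ⟨1 + ∑ j, (|l j| + |r j|), by positivity, fun i => ?_, fun i => ?_⟩
    · linarith [hle i, neg_abs_le (l i), abs_nonneg (r i)]
    · linarith [hle i, le_abs_self (r i), abs_nonneg (l i)]
  have hc : 0 < lam / (2 * K) := by positivity
  refine ⟨_, fun i => (l i + K) * (lam / (2 * K)), fun i => (r i + K) * (lam / (2 * K)),
    fun i => ⟨?_, ?_, ?_⟩, fun i j => ?_, rfl⟩
  · exact mul_nonneg (by linarith [hl i]) hc.le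
  · exact mul_lt_mul_of_pos_right (by linarith [hlr i]) hc
  · calc (r i + K) * (lam / (2 * K)) ≤ (2 * K) * (lam / (2 * K)) :=
          mul_le_mul_of_nonneg_right (by linarith [hr i]) hc.le
      _ = lam := by field_simp
  · rw [mul_le_mul_iff_left₀ hc, add_le_add_iff_right]

/-- The least nonnegative upper bound of the values of `f` on `P`. -/
theorem exists_least_nonneg_upper_bound {β : Type*} [Finite β] (f : β → ℝ) (P : β → Prop) :
    ∃ m : ℝ, 0 ≤ m ∧ (∀ b, P b → f b ≤ m) ∧
      ∀ c, 0 ≤ c → (∀ b, P b → f b ≤ c) → m ≤ c := by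
  have hbdd : BddAbove (insert 0 (f '' {b | P b})) :=
    ((Set.toFinite _).image f |>.insert 0).bddAbove
  refine ⟨sSup (insert 0 (f '' {b | P b})), le_csSup hbdd (Set.mem_insert _ _),
    fun b hb => le_csSup hbdd (Set.mem_insert_of_mem _ ⟨b, hb, rfl⟩), fun c hc h => ?_⟩
  refine csSup_le (Set.insert_nonempty _ _) ?_
  rintro x (rfl | ⟨b, hb, rfl⟩)
  exacts [hc, h b hb]

/-- Two layouts, of the members in `A` and of those outside `A`, can be merged by translating
each interval past all intervals of the other class that precede it. -/
theorem exists_merge {ι : Type*} [Finite ι] {l r : ι → ℝ} (hlr : ∀ i, l i < r i) (A : Set ι)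
    (hdisj : ∀ i j, ¬(i ∈ A ↔ j ∈ A) → r i ≤ l j ∨ r j ≤ l i) {L R : ι → ℝ} {lam mu : ℝ}
    (hlam : 0 ≤ lam) (hmu : 0 ≤ mu) (h0 : ∀ i, 0 ≤ L i) (hLR : ∀ i, L i < R i)
    (hRA : ∀ i ∈ A, R i ≤ lam) (hRB : ∀ i ∉ A, R i ≤ mu)
    (heq : ∀ i j, (i ∈ A ↔ j ∈ A) → (r i ≤ l j ↔ R i ≤ L j)) :
    ∃ s : ι → ℝ, (∀ i, 0 ≤ L i + s i ∧ R i + s i ≤ lam + mu) ∧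
      CombEquiv l r (fun i => L i + s i) (fun i => R i + s i) := by
  choose s hs0 hsle hsleast using fun i : ι =>
    exists_least_nonneg_upper_bound R (fun j => r j ≤ l i ∧ ¬(j ∈ A ↔ i ∈ A))
  have hcross : ∀ i j, ¬(i ∈ A ↔ j ∈ A) → r i ≤ l j → R i + s i ≤ L j + s j := by
    intro i j hij h
    have h1 : s i ≤ L j := by
      refine hsleast i _ (h0 j) fun k hk => ?_
      refine (heq k j (by tauto)).1 ?_
      linarith [hk.1, hlr i]
    linarith [hsle j i ⟨h, hij⟩]
  have hmono : ∀ i j, (i ∈ A ↔ j ∈ A) → l i < r j → s i ≤ s j := by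
    intro i j hij h
    refine hsleast i _ (hs0 j) fun k hk => hsle j k ⟨?_, by tauto⟩
    rcases hdisj k j (by tauto) with h1 | h1
    · exact h1
    · linarith [hk.1, hlr k]
  refine ⟨s, fun i => ⟨add_nonneg (h0 i) (hs0 i), ?_⟩, fun i j => ?_⟩
  · by_cases hi : i ∈ A
    · have := hsleast i mu hmu fun k hk => hRB k (by tauto)
      linarith [hRA i hi]
    · have := hsleast i lam hlam fun k hk => hRA k (by tauto)
      linarith [hRB i hi]
  · by_cases hij : i ∈ A ↔ j ∈ A
    · refine ⟨fun h => ?_, fun h => ?_⟩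
      · have h1 := (heq i j hij).1 h
        have h2 := hmono i j hij (by linarith [hlr i, hlr j])
        show R i + s i ≤ L j + s j
        linarith
      · by_contra hn
        have h1 : ¬ R i ≤ L j := fun h' => hn ((heq i j hij).2 h')
        have h2 := hmono j i hij.symm (by linarith)
        change R i + s i ≤ L j + s j at h
        linarith
    · refine ⟨hcross i j hij, fun h => ?_⟩
      rcases hdisj i j hij with h1 | h1
      · exact h1
      · have h2 := hcross j i (by tauto) h1
        change R i + s i ≤ L j + s j at h
        linarith [hLR i, hLR j]

/-- Collapsing the gaps of a layout fits it into an interval whose length is the measure of the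
union of its members. -/
theorem exists_collapse {ι : Type*} [Finite ι] {l r : ι → ℝ} (hlr : ∀ i, l i < r i) :
    ∃ l' r' : ι → ℝ, (∀ i, 0 ≤ l' i ∧ r' i ≤ volume.real (⋃ i, Set.Ioo (l i) (r i))) ∧
      (∀ i, r' i - l' i = r i - l i) ∧ CombEquiv l r l' r' := by
  set U := ⋃ i, Set.Ioo (l i) (r i) with hU
  have hfin : volume U ≠ ⊤ := by
    have : Bornology.IsBounded U := (Bornology.isBounded_iUnion).2 fun i => Metric.isBounded_Ioo _ _
    exact this.measure_lt_top.ne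
  set φ : ℝ → ℝ := fun x => volume.real (U ∩ Set.Iic x) with hφ
  have hmono : Monotone φ := fun x y hxy =>
    measureReal_mono (Set.inter_subset_inter_right _ (Set.Iic_subset_Iic.2 hxy))
      (measure_ne_top_of_subset Set.inter_subset_left hfin)
  have hstep : ∀ i x, l i ≤ x → x ≤ r i → φ x = φ (l i) + (x - l i) := by
    intro i x h1 h2
    have hsplit : (U ∩ Set.Iic x : Set ℝ) =ᵐ[volume]
        (U ∩ Set.Iic (l i) ∪ Set.Ioo (l i) x : Set ℝ) := by
      have hne : ∀ᵐ y : ℝ ∂volume, y ≠ x := by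
        simp [ae_iff]
      refine Filter.eventuallyEq_set.2 ?_
      filter_upwards [hne] with y hy
      constructor
      · rintro ⟨hyU, hyx⟩
        rcases le_or_gt y (l i) with h | h
        · exact Or.inl ⟨hyU, h⟩
        · exact Or.inr ⟨h, lt_of_le_of_ne hyx hy⟩
      · rintro (⟨hyU, hyl⟩ | ⟨h3, h4⟩)
        · exact ⟨hyU, le_trans hyl h1⟩
        · exact ⟨Set.mem_iUnion.2 ⟨i, h3, lt_of_lt_of_le h4 h2⟩, h4.le⟩
    show volume.real _ = volume.real _ + _
    rw [measureReal_congr hsplit, measureReal_union _ measurableSet_Ioo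
      (measure_ne_top_of_subset Set.inter_subset_left hfin) (by simp),
      Real.volume_real_Ioo_of_le h1]
    refine Set.disjoint_left.2 fun y hy hy' => ?_
    exact absurd hy.2 (not_le.2 hy'.1)
  refine ⟨fun i => φ (l i), fun i => φ (r i), fun i => ⟨measureReal_nonneg, ?_⟩, fun i => ?_,
    fun i j => ⟨fun h => hmono h, fun h => ?_⟩⟩
  · exact measureReal_mono Set.inter_subset_left hfin
  · have := hstep i (r i) (hlr i).le le_rfl
    simp only [this]; ring
  · by_contra! hn
    have h1 := hstep j (min (r i) (r j)) (le_min hn.le (hlr j).le) (min_le_right _ _)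
    have h2 := hmono (min_le_left (r i) (r j))
    have h3 := lt_min hn (hlr j)
    change φ (r i) ≤ φ (l j) at h
    linarith

/-- The collapsed layouts of a set of members and of its complement fit side by side. -/
theorem exists_split {ι : Type*} [Fintype ι] [DecidableEq ι] {l r L R : ι → ℝ} (A : Finset ι)
    (hA : A.Nonempty)
    (hB : Aᶜ.Nonempty) (hdisj : ∀ a ∈ A, ∀ b ∈ Aᶜ, r a ≤ l b ∨ r b ≤ l a) {t : ℝ}
    (h : ∀ i, 0 ≤ L i ∧ L i < R i ∧ R i ≤ t) (heq : CombEquiv l r L R) :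
    ∃ lam, 0 < lam ∧ lam < t ∧
      (∑ i : A, Real.logb 2 (R i - L i)) ∈
        intervalESet (fun a : A => l a) (fun a : A => r a) lam ∧
      (∑ i : (Aᶜ : Finset ι), Real.logb 2 (R i - L i)) ∈
        intervalESet (fun b : (Aᶜ : Finset ι) => l b) (fun b : (Aᶜ : Finset ι) => r b)
          (t - lam) := by
  obtain ⟨lA, rA, hA1, hA2, hA3⟩ :=
    exists_collapse (l := fun a : A => L a) (r := fun a : A => R a) fun a => (h a).2.1
  obtain ⟨lB, rB, hB1, hB2, hB3⟩ :=
    exists_collapse (l := fun b : (Aᶜ : Finset ι) => L b)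
      (r := fun b : (Aᶜ : Finset ι) => R b) fun b => (h b).2.1
  set U := ⋃ a : A, Set.Ioo (L a) (R a)
  set V := ⋃ b : (Aᶜ : Finset ι), Set.Ioo (L b) (R b)
  obtain ⟨a, ha⟩ := hA
  obtain ⟨b, hb⟩ := hB
  have ht : 0 ≤ t := by linarith [h a]
  have hUV : Disjoint U V := by
    refine Set.disjoint_iUnion_left.2 fun i => Set.disjoint_iUnion_right.2 fun j => ?_
    refine Set.disjoint_left.2 fun x hx hy => ?_
    rcases hdisj i i.2 j j.2 with h1 | h1
    · linarith [(heq i j).1 h1, hx.2, hy.1]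
    · linarith [(heq j i).1 h1, hy.2, hx.1]
  have hsub : U ∪ V ⊆ Set.Ioo 0 t := by
    refine Set.union_subset (Set.iUnion_subset fun i => ?_) (Set.iUnion_subset fun i => ?_) <;>
    exact Set.Ioo_subset_Ioo (h i).1 (h i).2.2
  have hle : volume.real U + volume.real V ≤ t := by
    have hV : MeasurableSet V := MeasurableSet.iUnion fun i => measurableSet_Ioo
    have hne : volume (U ∪ V) ≠ ⊤ := measure_ne_top_of_subset hsub (by simp)
    rw [← measureReal_union hUV hV (measure_ne_top_of_subset Set.subset_union_left hne)
      (measure_ne_top_of_subset Set.subset_union_right hne)]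
    calc volume.real (U ∪ V) ≤ volume.real (Set.Ioo 0 t) := measureReal_mono hsub (by simp)
      _ = t := by rw [Real.volume_real_Ioo_of_le ht, sub_zero]
  have ha' := h a
  have hb' := h b
  refine ⟨volume.real U, ?_, ?_, ⟨lA, rA, fun i => ⟨(hA1 i).1, ?_, (hA1 i).2⟩, fun i j => ?_, ?_⟩,
    ⟨lB, rB, fun i => ⟨(hB1 i).1, ?_, ?_⟩, fun i j => ?_, ?_⟩⟩
  · linarith [hA1 ⟨a, ha⟩, hA2 ⟨a, ha⟩]
  · linarith [hB1 ⟨b, hb⟩, hB2 ⟨b, hb⟩]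
  · linarith [hA2 i, h i]
  · exact (heq i j).trans (hA3 i j)
  · simp only [hA2]
  · linarith [hB2 i, h i]
  · linarith [hB1 i]
  · exact (heq i j).trans (hB3 i j)
  · simp only [hB2]

theorem add_mem_intervalESet {ι : Type*} [Fintype ι] [DecidableEq ι] {l r : ι → ℝ}
    (hlr : ∀ i, l i < r i)
    (A : Finset ι) (hdisj : ∀ a ∈ A, ∀ b ∈ Aᶜ, r a ≤ l b ∨ r b ≤ l a)
    {lam mu x y : ℝ} (hlam : 0 ≤ lam) (hmu : 0 ≤ mu)
    (hx : x ∈ intervalESet (fun a : A => l a) (fun a : A => r a) lam)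
    (hy : y ∈ intervalESet (fun b : (Aᶜ : Finset ι) => l b)
      (fun b : (Aᶜ : Finset ι) => r b) mu) :
    x + y ∈ intervalESet l r (lam + mu) := by
  obtain ⟨lA, rA, hA, hA', rfl⟩ := hx
  obtain ⟨lB, rB, hB, hB', rfl⟩ := hy
  set L : ι → ℝ := fun i => if hi : i ∈ A then lA ⟨i, hi⟩ else lB ⟨i, Finset.mem_compl.2 hi⟩
  set R : ι → ℝ := fun i => if hi : i ∈ A then rA ⟨i, hi⟩ else rB ⟨i, Finset.mem_compl.2 hi⟩
  have hLA : ∀ i (hi : i ∈ A), L i = lA ⟨i, hi⟩ := fun i hi => dif_pos hi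
  have hRA : ∀ i (hi : i ∈ A), R i = rA ⟨i, hi⟩ := fun i hi => dif_pos hi
  have hLB : ∀ i (hi : i ∉ A), L i = lB ⟨i, Finset.mem_compl.2 hi⟩ := fun i hi => dif_neg hi
  have hRB : ∀ i (hi : i ∉ A), R i = rB ⟨i, Finset.mem_compl.2 hi⟩ := fun i hi => dif_neg hi
  have h0 : ∀ i, 0 ≤ L i := fun i => by
    by_cases hi : i ∈ A
    · rw [hLA i hi]; exact (hA _).1
    · rw [hLB i hi]; exact (hB _).1
  have hLR : ∀ i, L i < R i := fun i => by
    by_cases hi : i ∈ A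
    · rw [hLA i hi, hRA i hi]; exact (hA _).2.1
    · rw [hLB i hi, hRB i hi]; exact (hB _).2.1
  obtain ⟨s, hs, hs'⟩ := exists_merge (l := l) (r := r) (L := L) (R := R) hlr (A : Set ι)
    (fun i j hij => by
      simp only [Finset.mem_coe] at hij
      by_cases hi : i ∈ A
      · exact hdisj i hi j (Finset.mem_compl.2 (by tauto))
      · exact (hdisj j (by tauto) i (Finset.mem_compl.2 hi)).symm)
    hlam hmu h0 hLR
    (fun i hi => by rw [hRA i hi]; exact (hA _).2.2)
    (fun i hi => by rw [hRB i hi]; exact (hB _).2.2)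
    (fun i j hij => by
      simp only [Finset.mem_coe] at hij
      by_cases hi : i ∈ A
      · rw [hRA i hi, hLA j (hij.1 hi)]; exact hA' ⟨i, hi⟩ ⟨j, hij.1 hi⟩
      · have hj : j ∉ A := fun hj => hi (hij.2 hj)
        rw [hRB i hi, hLB j hj]
        exact hB' ⟨i, Finset.mem_compl.2 hi⟩ ⟨j, Finset.mem_compl.2 hj⟩)
  refine ⟨_, _, fun i => ⟨(hs i).1, add_lt_add_left (hLR i) _, (hs i).2⟩, hs', ?_⟩
  simp only [add_sub_add_right_eq_sub]
  rw [← Finset.sum_add_sum_compl A, ← Finset.sum_coe_sort A, ← Finset.sum_coe_sort Aᶜ]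
  congr 1
  · exact Finset.sum_congr rfl fun i _ => by rw [hLA i i.2, hRA i i.2]
  · exact Finset.sum_congr rfl fun i _ => by
      rw [hLB i (Finset.mem_compl.1 i.2), hRB i (Finset.mem_compl.1 i.2)]

theorem stmt5 (n : ℕ) (hn : 1 ≤ n) (l r : Fin n → ℝ) (hlr : ∀ i, l i < r i)
    (A : Finset (Fin n)) (hA : A.Nonempty) (hB : Aᶜ.Nonempty)
    (hdisj : ∀ a ∈ A, ∀ b ∈ Aᶜ,
      Set.Ioo (l a) (r a) ∩ Set.Ioo (l b) (r b) = ∅) :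
    intervalE l r (n : ℝ) =
      sSup { x : ℝ | ∃ lam : ℝ, 0 < lam ∧ lam < (n : ℝ) ∧
        x = intervalE (fun a : A => l a) (fun a : A => r a) lam +
            intervalE (fun b : (Aᶜ : Finset (Fin n)) => l b)
              (fun b : (Aᶜ : Finset (Fin n)) => r b) ((n : ℝ) - lam) } := by
  have hcmp : ∀ a ∈ A, ∀ b ∈ Aᶜ, r a ≤ l b ∨ r b ≤ l a := by
    intro a ha b hb
    have h := hdisj a ha b hb
    rw [Set.Ioo_inter_Ioo, Set.Ioo_eq_empty_iff, not_lt] at h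
    rcases le_sup_iff.1 h with h | h <;> rcases inf_le_iff.1 h with h | h
    · exact absurd h (not_le.2 (hlr a))
    · exact Or.inr h
    · exact Or.inl h
    · exact absurd h (not_le.2 (hlr b))
  have hn0 : (0 : ℝ) < n := by exact_mod_cast hn
  have hupper : ∀ lam : ℝ, 0 < lam → lam < n →
      intervalE (fun a : A => l a) (fun a : A => r a) lam +
        intervalE (fun b : (Aᶜ : Finset (Fin n)) => l b)
          (fun b : (Aᶜ : Finset (Fin n)) => r b) ((n : ℝ) - lam) ≤ intervalE l r n := by
    intro lam h0 h1
    have hmu : 0 < (n : ℝ) - lam := sub_pos.2 h1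
    rw [← le_sub_iff_add_le]
    refine csSup_le (intervalESet_nonempty (fun a : A => hlr a) h0) fun x hx => ?_
    rw [le_sub_comm]
    refine csSup_le (intervalESet_nonempty (fun b : (Aᶜ : Finset (Fin n)) => hlr b) hmu)
      fun y hy => ?_
    rw [le_sub_iff_add_le']
    refine le_csSup (bddAbove_intervalESet l r n) ?_
    have hxy := add_mem_intervalESet hlr A hcmp h0.le hmu.le hx hy
    rwa [add_sub_cancel] at hxy
  apply le_antisymm
  · refine csSup_le (intervalESet_nonempty hlr hn0) ?_
    rintro x ⟨L, R, h, heq, rfl⟩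
    obtain ⟨lam, h0, h1, hx, hy⟩ := exists_split A hA hB hcmp h heq
    refine le_trans ?_ (le_csSup ⟨intervalE l r n, ?_⟩ ⟨lam, h0, h1, rfl⟩)
    · rw [← Finset.sum_add_sum_compl A, ← Finset.sum_coe_sort A, ← Finset.sum_coe_sort Aᶜ]
      exact add_le_add (le_csSup (bddAbove_intervalESet _ _ _) hx)
        (le_csSup (bddAbove_intervalESet _ _ _) hy)
    · rintro _ ⟨mu, h0, h1, rfl⟩
      exact hupper mu h0 h1
  · refine csSup_le ⟨_, (n : ℝ) / 2, half_pos hn0, half_lt_self hn0, rfl⟩ ?_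
    rintro _ ⟨lam, h0, h1, rfl⟩
    exact hupper lam h0 h1
end

section
/- For any containment-compatible processing order π of the family R, Σ_{i=1}^n log₂( (|Γ_i| + 1)/2 ) ≤ E(R, n) = n·H(R). -/
open scoped Classical

open Finset

section StretchedFamily

variable {ι : Type*} [Fintype ι] (l r : ι → ℝ)

/-- Half the number of endpoints of the family lying before `l i`, where two left endpoints
count as simultaneous when no right endpoint separates them. -/
noncomputable def stretchedLeft (i : ι) : ℝ :=
  ((#{k | r k ≤ l i} : ℝ) + #{k | ∃ m, l k < r m ∧ r m ≤ l i}) / 2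

/-- Half the number of endpoints of the family lying at or before `r i`, where two right
endpoints count as simultaneous when no left endpoint separates them. -/
noncomputable def stretchedRight (i : ι) : ℝ :=
  ((#{k | ¬ ∃ m, r i ≤ l m ∧ l m < r k} : ℝ) + #{k | l k < r i}) / 2

lemma stretchedLeft_nonneg (i : ι) : 0 ≤ stretchedLeft l r i := by
  unfold stretchedLeft; positivity

lemma stretchedRight_le_card (i : ι) : stretchedRight l r i ≤ Fintype.card ι := by
  have h₁ : (#{k | ¬ ∃ m, r i ≤ l m ∧ l m < r k} : ℝ) ≤ Fintype.card ι := by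
    exact_mod_cast card_le_univ _
  have h₂ : (#{k | l k < r i} : ℝ) ≤ Fintype.card ι := by exact_mod_cast card_le_univ _
  unfold stretchedRight
  linarith

variable {l r}

lemma stretchedRight_le_stretchedLeft {i j : ι} (h : r i ≤ l j) :
    stretchedRight l r i ≤ stretchedLeft l r j := by
  unfold stretchedLeft stretchedRight
  gcongr with k _ k _
  · intro hk
    by_contra! hlt
    exact hk ⟨j, h, hlt⟩
  · exact fun hk => ⟨i, hk, h⟩

lemma stretchedLeft_lt_stretchedRight {i j : ι} (h : l j < r i) :
    stretchedLeft l r j < stretchedRight l r i := by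
  have h₁ : (#{k | r k ≤ l j} : ℝ) ≤ #{k | ¬ ∃ m, r i ≤ l m ∧ l m < r k} := by
    gcongr with k _
    rintro hk ⟨m, hm, hm'⟩
    linarith
  have h₂ : (#{k | ∃ m, l k < r m ∧ r m ≤ l j} : ℝ) < #{k | l k < r i} := by
    rw [Nat.cast_lt]
    refine card_lt_card (ssubset_iff_of_subset ?_ |>.2 ⟨j, by simpa using h, ?_⟩)
    · intro k hk
      simp only [mem_filter, mem_univ, true_and] at hk ⊢
      obtain ⟨m, hm, hm'⟩ := hk
      linarith
    · simp only [mem_filter, mem_univ, true_and]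
      rintro ⟨m, hm, hm'⟩
      linarith
  unfold stretchedLeft stretchedRight
  linarith

lemma combEquiv_stretched : CombEquiv l r (stretchedLeft l r) (stretchedRight l r) :=
  fun _ _ => ⟨stretchedRight_le_stretchedLeft, fun h => le_of_not_gt fun hlt =>
    (stretchedLeft_lt_stretchedRight hlt).not_ge h⟩

/-- If `Γ` consists of intervals that meet `(l i, r i)` and do not extend beyond it on both
sides, then the stretched `i`-th interval has length at least `(|Γ| + 1) / 2`. -/
lemma card_add_one_div_two_le_stretched {i : ι} (hi : l i < r i) (Γ : Finset ι)
    (hΓ : ∀ k ∈ Γ, l k < r i ∧ l i < r k ∧ (l i ≤ l k ∨ r k ≤ r i)) :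
    ((#Γ : ℝ) + 1) / 2 ≤ stretchedRight l r i - stretchedLeft l r i := by
  set P : Finset ι := {k | r k ≤ l i}
  set Q : Finset ι := {k | ∃ m, l k < r m ∧ r m ≤ l i}
  set S : Finset ι := {k | ¬ ∃ m, r i ≤ l m ∧ l m < r k}
  set T : Finset ι := {k | l k < r i}
  have hPS : P ⊆ S := by
    intro k hk
    simp only [P, S, mem_filter, mem_univ, true_and] at hk ⊢
    rintro ⟨m, hm, hm'⟩
    linarith
  have hQT : Q ⊆ T := by
    intro k hk
    simp only [Q, T, mem_filter, mem_univ, true_and] at hk ⊢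
    obtain ⟨m, hm, hm'⟩ := hk
    linarith
  have hunion : Γ ⊆ (S \ P) ∪ (T \ Q) := by
    intro k hk
    obtain ⟨h₁, h₂, h₃⟩ := hΓ k hk
    simp only [P, Q, S, T, mem_union, mem_sdiff, mem_filter, mem_univ, true_and]
    rcases h₃ with h₃ | h₃
    · refine Or.inr ⟨h₁, ?_⟩
      rintro ⟨m, hm, hm'⟩
      linarith
    · refine Or.inl ⟨?_, not_le.2 h₂⟩
      rintro ⟨m, hm, hm'⟩
      linarith
  have hinter : i ∈ (S \ P) ∩ (T \ Q) := by
    simp only [P, Q, S, T, mem_inter, mem_sdiff, mem_filter, mem_univ, true_and]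
    refine ⟨⟨?_, not_le.2 hi⟩, hi, ?_⟩ <;>
    · rintro ⟨m, hm, hm'⟩
      linarith
  have hcard : #Γ + 1 ≤ #(S \ P) + #(T \ Q) := by
    rw [← card_union_add_card_inter]
    exact Nat.add_le_add (card_le_card hunion) (card_pos.2 ⟨i, hinter⟩)
  have hS : (#(S \ P) : ℝ) + #P = #S := by exact_mod_cast card_sdiff_add_card_eq_card hPS
  have hT : (#(T \ Q) : ℝ) + #Q = #T := by exact_mod_cast card_sdiff_add_card_eq_card hQT
  have hcard' : (#Γ : ℝ) + 1 ≤ #(S \ P) + #(T \ Q) := by exact_mod_cast hcard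
  change _ ≤ ((#S : ℝ) + #T) / 2 - ((#P : ℝ) + #Q) / 2
  linarith

end StretchedFamily

lemma le_intervalE {ι : Type*} [Fintype ι] {l r l' r' : ι → ℝ} {lam : ℝ}
    (h : ∀ i, 0 ≤ l' i ∧ l' i < r' i ∧ r' i ≤ lam) (he : CombEquiv l r l' r') :
    ∑ i, Real.logb 2 (r' i - l' i) ≤ intervalE l r lam := by
  refine le_csSup ⟨∑ _i : ι, Real.logb 2 lam, ?_⟩ ⟨l', r', h, he, rfl⟩
  rintro _ ⟨a, b, hab, -, rfl⟩
  refine sum_le_sum fun i _ => ?_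
  obtain ⟨h₀, h₁, h₂⟩ := hab i
  exact Real.logb_le_logb_of_le one_lt_two (by linarith) (by linarith)

theorem stmt7 (n : ℕ) (hn : 1 ≤ n) (l r : Fin n → ℝ) (hlr : ∀ i, l i < r i)
    (π : Equiv.Perm (Fin n))
    (hcc : ContainmentCompatible n (l ∘ π) (r ∘ π)) :
    (∑ i : Fin n,
        Real.logb 2 ((((contact n (l ∘ π) (r ∘ π) i).card : ℝ) + 1) / 2))
      ≤ intervalE l r (n : ℝ) ∧
    intervalE l r (n : ℝ) = (n : ℝ) * intervalEntropy n l r := by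
  have hn₀ : (n : ℝ) ≠ 0 := by exact_mod_cast Nat.one_le_iff_ne_zero.1 hn
  refine ⟨?_, (mul_div_cancel₀ _ hn₀).symm⟩
  have hE := le_intervalE (lam := n) (fun i => ⟨stretchedLeft_nonneg l r i,
    stretchedLeft_lt_stretchedRight (hlr i),
    by simpa using stretchedRight_le_card l r i⟩) combEquiv_stretched
  refine le_trans ?_ hE
  rw [← Equiv.sum_comp π fun i => Real.logb 2 (stretchedRight l r i - stretchedLeft l r i)]
  refine sum_le_sum fun i _ => Real.logb_le_logb_of_le one_lt_two (by positivity) ?_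
  rw [← card_map π.toEmbedding]
  refine card_add_one_div_two_le_stretched (hlr _) _ fun k hk => ?_
  obtain ⟨j, hj, rfl⟩ := mem_map.1 hk
  simp only [contact, mem_filter, mem_univ, true_and, Function.comp_apply] at hj
  obtain ⟨hji, x, ⟨hx₁, hx₂⟩, hx₃, hx₄⟩ := hj
  refine ⟨hx₁.trans hx₄, hx₃.trans hx₂, ?_⟩
  by_contra! hlt
  obtain ⟨hl, hr⟩ := hlt
  refine (hcc i j ?_).not_ge hji
  refine (Set.ssubset_iff_of_subset (Set.Ioo_subset_Ioo hl.le hr.le)).2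
    ⟨l (π i), ⟨hl, (hlr _).trans hr⟩, fun h => lt_irrefl _ h.1⟩
end

section
/- There exists a containment-compatible processing order π of the family R that realizes the ambiguity, i.e., with A^π(R) = A(R). -/
open scoped Classical

lemma prod_sub_one_mul_le {V : Type*} {D : Finset V} {g : V → ℝ} {x : ℝ}
    (hg : ∀ v ∈ D, 1 ≤ g v) (hx : ∀ v ∈ D, g v ≤ x) (hx0 : 0 < x) :
    (∏ v ∈ D, (g v - 1)) * (x + D.card) ≤ x * ∏ v ∈ D, g v ∧
      (D.Nonempty → (∏ v ∈ D, (g v - 1)) * (x + D.card) < x * ∏ v ∈ D, g v) := by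
  induction D using Finset.induction_on with
  | empty => simp
  | insert k D hk ih =>
    have ih' := (ih (fun v hv => hg v (Finset.mem_insert_of_mem hv))
      (fun v hv => hx v (Finset.mem_insert_of_mem hv))).1
    have h1 := hg k (Finset.mem_insert_self _ _)
    have h2 := hx k (Finset.mem_insert_self _ _)
    have hQ : 0 < ∏ v ∈ D, g v := Finset.prod_pos fun v hv =>
      lt_of_lt_of_le one_pos (hg v (Finset.mem_insert_of_mem hv))
    have hQ' : 0 ≤ ∏ v ∈ D, (g v - 1) := Finset.prod_nonneg fun v hv =>
      sub_nonneg.2 (hg v (Finset.mem_insert_of_mem hv))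
    rw [Finset.prod_insert hk, Finset.prod_insert hk, Finset.card_insert_of_notMem hk]
    push_cast
    have key : (g k - 1) * (∏ v ∈ D, (g v - 1)) * (x + (D.card + 1)) <
        x * (g k * ∏ v ∈ D, g v) := by
      have hd : (0 : ℝ) ≤ D.card := Nat.cast_nonneg _
      rcases hQ'.eq_or_lt with h0 | h0
      · rw [← h0]; simp only [mul_zero, zero_mul]; positivity
      · calc (g k - 1) * (∏ v ∈ D, (g v - 1)) * (x + (D.card + 1))
            = (∏ v ∈ D, (g v - 1)) * ((g k - 1) * (x + (D.card + 1))) := by ring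
          _ < (∏ v ∈ D, (g v - 1)) * (g k * (x + D.card)) :=
              mul_lt_mul_of_pos_left (by nlinarith) h0
          _ = g k * ((∏ v ∈ D, (g v - 1)) * (x + D.card)) := by ring
          _ ≤ g k * (x * ∏ v ∈ D, g v) := mul_le_mul_of_nonneg_left ih' (by linarith)
          _ = x * (g k * ∏ v ∈ D, g v) := by ring
    exact ⟨key.le, fun _ => key⟩

lemma injective_comp_swap {V : Type*} [DecidableEq V] {f : V → ℕ} {i j : V} (hf : f.Injective) :
    (f ∘ Equiv.swap i j).Injective :=
  hf.comp (Equiv.injective _)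

lemma mul_lt_of_le_or_lt {a b m d Q Q' : ℝ} (ha : 0 < a) (hab : a ≤ b) (hm : 0 ≤ m) (hQ : 0 < Q)
    (hle : Q' * (b + m + 1 + d) ≤ (b + m + 1) * Q)
    (hlt : a < b ∨ Q' * (b + m + 1 + d) < (b + m + 1) * Q) :
    a * (b + m + 1 + d) * Q' < (a + m + 1) * b * Q := by
  rcases hlt with hlt | hlt
  · calc a * (b + m + 1 + d) * Q' = a * (Q' * (b + m + 1 + d)) := by ring
      _ ≤ a * ((b + m + 1) * Q) := mul_le_mul_of_nonneg_left hle ha.le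
      _ = a * (b + m + 1) * Q := by ring
      _ < (a + m + 1) * b * Q := mul_lt_mul_of_pos_right (by nlinarith) hQ
  · calc a * (b + m + 1 + d) * Q' = a * (Q' * (b + m + 1 + d)) := by ring
      _ < a * ((b + m + 1) * Q) := mul_lt_mul_of_pos_left hlt ha
      _ = a * (b + m + 1) * Q := by ring
      _ ≤ (a + m + 1) * b * Q := mul_le_mul_of_nonneg_right (by nlinarith) hQ.le

section ContactCount

variable {V : Type*} [Fintype V]

/-- The elements related to `v` whose rank is at most that of `v`. -/
noncomputable def earlier (A : V → V → Prop) (f : V → ℕ) (v : V) : Finset V :=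
  Finset.univ.filter fun u => f u ≤ f v ∧ A u v

/-- The elements related to `v` whose rank is below `p`. -/
noncomputable def before (A : V → V → Prop) (f : V → ℕ) (p : ℕ) (v : V) : Finset V :=
  Finset.univ.filter fun u => f u < p ∧ A u v

/-- The elements related to `v` whose rank is strictly between `p` and `q`. -/
noncomputable def between (A : V → V → Prop) (f : V → ℕ) (p q : ℕ) (v : V) : Finset V :=
  Finset.univ.filter fun u => (p < f u ∧ f u < q) ∧ A u v

variable {A : V → V → Prop} {f : V → ℕ} {i j : V}

lemma card_earlier_pos (hr : ∀ v, A v v) (v : V) : 0 < (earlier A f v).card :=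
  Finset.card_pos.2 ⟨v, by simp [earlier, hr]⟩

variable [DecidableEq V]

lemma card_earlier_eq_before (hr : ∀ v, A v v) (hf : f.Injective) (j : V) :
    (earlier A f j).card = (before A f (f j) j).card + 1 := by
  have h : earlier A f j = insert j (before A f (f j) j) := by
    ext u
    rcases eq_or_ne u j with rfl | hu
    · simp [earlier, hr]
    · have := hf.ne hu
      simp only [earlier, before, Finset.mem_insert, Finset.mem_filter, Finset.mem_univ, true_and,
        hu, false_or]
      constructor <;> rintro ⟨h1, h2⟩ <;> exact ⟨by omega, h2⟩
  rw [h, Finset.card_insert_of_notMem (by simp [before])]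

lemma card_earlier_split (hr : ∀ v, A v v) (hf : f.Injective) (hji : f j < f i) :
    (earlier A f i).card = (before A f (f j) i).card + (between A f (f j) (f i) i).card
      + (if A j i then 1 else 0) + 1 := by
  have hd : Disjoint (before A f (f j) i) (between A f (f j) (f i) i) := by
    rw [Finset.disjoint_left]
    intro u hu hu'
    simp only [before, between, Finset.mem_filter, Finset.mem_univ, true_and] at hu hu'
    omega
  have hd' : Disjoint (before A f (f j) i ∪ between A f (f j) (f i) i)
      (if A j i then {j} else ∅) := by
    split_ifs <;> simp [before, between]
  have h : before A f (f i) i = (before A f (f j) i ∪ between A f (f j) (f i) i) ∪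
      (if A j i then {j} else ∅) := by
    ext u
    rcases eq_or_ne u j with rfl | hu
    · by_cases hA : A u i <;> simp [before, between, hA, hji]
    · have := hf.ne hu
      have hno : u ∉ (if A j i then {j} else ∅ : Finset V) := by split_ifs <;> simp [hu]
      simp only [before, between, Finset.mem_union, Finset.mem_filter, Finset.mem_univ, true_and,
        hno, or_false]
      by_cases hA : A u i
      · simp only [hA, and_true]; omega
      · simp [hA]
  rw [card_earlier_eq_before hr hf, h, Finset.card_union_of_disjoint hd',
    Finset.card_union_of_disjoint hd]
  split_ifs <;> simp

lemma before_swap (hji : f j < f i) (v : V) :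
    before A (f ∘ Equiv.swap i j) (f j) v = before A f (f j) v := by
  ext u
  rcases eq_or_ne u i with rfl | hi
  · simp [before, hji.not_gt]
  rcases eq_or_ne u j with rfl | hj
  · simp [before, hji.not_gt]
  simp [before, Equiv.swap_apply_of_ne_of_ne hi hj]

lemma between_swap (v : V) :
    between A (f ∘ Equiv.swap i j) (f j) (f i) v = between A f (f j) (f i) v := by
  ext u
  rcases eq_or_ne u i with rfl | hi
  · simp [between]
  rcases eq_or_ne u j with rfl | hj
  · simp [between]
  simp [between, Equiv.swap_apply_of_ne_of_ne hi hj]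

lemma card_earlier_swap_left (hr : ∀ v, A v v) (hf : f.Injective) (hji : f j < f i) :
    (earlier A (f ∘ Equiv.swap i j) i).card = (before A f (f j) i).card + 1 := by
  rw [card_earlier_eq_before hr (injective_comp_swap hf)]
  simp only [Function.comp_apply, Equiv.swap_apply_left]
  rw [before_swap hji]

lemma card_earlier_swap_right (hr : ∀ v, A v v) (hf : f.Injective) (hji : f j < f i) :
    (earlier A (f ∘ Equiv.swap i j) j).card = (before A f (f j) j).card
      + (between A f (f j) (f i) j).card + (if A i j then 1 else 0) + 1 := by
  have h := card_earlier_split (A := A) (j := i) (i := j) hr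
    (injective_comp_swap (i := i) (j := j) hf) (by simpa using hji)
  simp only [Function.comp_apply, Equiv.swap_apply_left, Equiv.swap_apply_right] at h
  rw [h, before_swap hji, between_swap]

lemma earlier_swap_of_outside {v : V} (hji : f j < f i) (hv : f v < f j ∨ f i < f v) :
    earlier A (f ∘ Equiv.swap i j) v = earlier A f v := by
  have hvi : v ≠ i := by rintro rfl; omega
  have hvj : v ≠ j := by rintro rfl; omega
  ext u
  simp only [earlier, Finset.mem_filter, Finset.mem_univ, true_and, Function.comp_apply,
    Equiv.swap_apply_of_ne_of_ne hvi hvj]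
  rcases eq_or_ne u i with rfl | hi
  · rw [Equiv.swap_apply_left]
    exact and_congr_left fun _ => by omega
  rcases eq_or_ne u j with rfl | hj
  · rw [Equiv.swap_apply_right]
    exact and_congr_left fun _ => by omega
  rw [Equiv.swap_apply_of_ne_of_ne hi hj]

lemma card_earlier_swap_of_between {v : V} (hjv : f j < f v) (hvi : f v < f i) :
    (earlier A (f ∘ Equiv.swap i j) v).card + (if A j v then 1 else 0) =
      (earlier A f v).card + (if A i v then 1 else 0) := by
  have hv1 : v ≠ i := by rintro rfl; omega
  have hv2 : v ≠ j := by rintro rfl; omega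
  have hij : i ≠ j := by rintro rfl; omega
  set S := earlier A f v \ {j} with hS
  have hSi : i ∉ S := by simp [hS, earlier, hvi]
  have h1 : earlier A f v = S ∪ (if A j v then {j} else ∅) := by
    ext u
    rcases eq_or_ne u j with rfl | hj
    · by_cases h : A u v <;> simp [hS, earlier, h, hjv.le]
    · split_ifs <;> simp [hS, hj]
  have h2 : earlier A (f ∘ Equiv.swap i j) v = S ∪ (if A i v then {i} else ∅) := by
    ext u
    rcases eq_or_ne u i with rfl | hi
    · by_cases h : A u v <;>
        simp [hS, earlier, h, hjv.le, Equiv.swap_apply_of_ne_of_ne hv1 hv2]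
    rcases eq_or_ne u j with rfl | hj
    · split_ifs <;>
        simp [hS, earlier, hvi, hi, Equiv.swap_apply_of_ne_of_ne hv1 hv2]
    · split_ifs <;>
        simp [hS, earlier, hi, hj, Equiv.swap_apply_of_ne_of_ne hv1 hv2,
          Equiv.swap_apply_of_ne_of_ne hi hj]
  rw [h2, h1, Finset.card_union_of_disjoint (by split_ifs <;> simp [hSi]),
    Finset.card_union_of_disjoint (by split_ifs <;> simp [hS])]
  split_ifs <;> simp

lemma prod_split_pair (hij : i ≠ j) (g : V → ℝ) :
    ∏ v, g v = g i * g j * ∏ v ∈ Finset.univ \ {i, j}, g v := by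
  rw [← Finset.prod_pair hij, mul_comm, Finset.prod_sdiff (Finset.subset_univ _)]

lemma sum_split_pair (hij : i ≠ j) (g : V → ℝ) :
    ∑ v, g v = g i + g j + ∑ v ∈ Finset.univ \ {i, j}, g v := by
  rw [← Finset.sum_pair hij, add_comm, Finset.sum_sdiff (Finset.subset_univ _)]

/-- Exchanging consecutive elements that are in the wrong order with respect to the size of
their contact sets either improves the product of these sizes or leaves all sizes unchanged. -/
lemma swap_consecutive (hr : ∀ v, A v v) (hs : ∀ u v, A u v → A v u) (hf : f.Injective)
    (hji : f i = f j + 1) (hG : (earlier A f i).card < (earlier A f j).card) :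
    (∏ v, ((earlier A (f ∘ Equiv.swap i j) v).card : ℝ) < ∏ v, ((earlier A f v).card : ℝ)) ∨
      ∀ v, (earlier A (f ∘ Equiv.swap i j) v).card = (earlier A f v).card := by
  have hlt : f j < f i := by omega
  have hij : i ≠ j := by rintro rfl; omega
  have hb : ∀ v, between A f (f j) (f i) v = ∅ := by
    intro v
    ext u
    simp only [between, Finset.mem_filter, Finset.mem_univ, true_and, Finset.notMem_empty,
      iff_false, not_and]
    intro h
    omega
  have ho : ∀ v, v ≠ i → v ≠ j → earlier A (f ∘ Equiv.swap i j) v = earlier A f v := by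
    intro v hi hj
    have := hf.ne hi
    have := hf.ne hj
    exact earlier_swap_of_outside hlt (by omega)
  have ei := card_earlier_split (A := A) hr hf hlt
  have ej := card_earlier_eq_before (A := A) hr hf j
  have ei' := card_earlier_swap_left (A := A) hr hf hlt
  have ej' := card_earlier_swap_right (A := A) hr hf hlt
  simp only [hb, Finset.card_empty, add_zero] at ei ej'
  by_cases hA : A j i
  · left
    have hA' := hs _ _ hA
    simp only [hA, hA', if_true] at ei ej'
    rw [prod_split_pair hij, prod_split_pair hij (fun v => ((earlier A f v).card : ℝ))]
    have : ∏ v ∈ Finset.univ \ {i, j}, ((earlier A (f ∘ Equiv.swap i j) v).card : ℝ) =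
        ∏ v ∈ Finset.univ \ {i, j}, ((earlier A f v).card : ℝ) :=
      Finset.prod_congr rfl fun v hv => by
        simp only [Finset.mem_sdiff, Finset.mem_univ, Finset.mem_insert, Finset.mem_singleton,
          true_and, not_or] at hv
        rw [ho v hv.1 hv.2]
    rw [this]
    refine mul_lt_mul_of_pos_right ?_ (Finset.prod_pos fun v _ =>
      Nat.cast_pos.2 (card_earlier_pos hr v))
    rw [ei', ej', ei, ej]
    norm_cast
    have : (before A f (f j) i).card < (before A f (f j) j).card := by omega
    nlinarith
  · right
    have hA' : ¬ A i j := fun h => hA (hs _ _ h)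
    simp only [hA, hA', if_false] at ei ej'
    intro v
    by_cases hi : v = i
    · subst hi; omega
    by_cases hj : v = j
    · subst hj; omega
    rw [ho v hi hj]

/-- Exchanging `i` with an earlier element `j` that dominates it either improves the product of
the sizes of the contact sets, or changes only the sizes at `i` and `j`, by opposite amounts. -/
lemma swap_dominated (hr : ∀ v, A v v) (hs : ∀ u v, A u v → A v u) (hf : f.Injective)
    (hlt : f j < f i) (hdom : ∀ u, A u i → A u j)
    (hmono : ∀ v, f v < f i → (earlier A f v).card ≤ (earlier A f i).card) :
    (∏ v, ((earlier A (f ∘ Equiv.swap i j) v).card : ℝ) < ∏ v, ((earlier A f v).card : ℝ)) ∨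
      ((∀ v, v ≠ i → v ≠ j → (earlier A (f ∘ Equiv.swap i j) v).card = (earlier A f v).card) ∧
        (earlier A (f ∘ Equiv.swap i j) i).card = (earlier A f j).card ∧
        (earlier A (f ∘ Equiv.swap i j) j).card = (earlier A f i).card ∧
        (earlier A f j).card < (earlier A f i).card) := by
  have hij : i ≠ j := by rintro rfl; omega
  have hAij : A i j := hdom i (hr i)
  have hAji : A j i := hs _ _ hAij
  have ei := card_earlier_split (A := A) hr hf hlt
  have ej := card_earlier_eq_before (A := A) hr hf j
  have ei' := card_earlier_swap_left (A := A) hr hf hlt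
  have ej' := card_earlier_swap_right (A := A) hr hf hlt
  simp only [hAij, hAji, if_true] at ei ej'
  set D := between A f (f j) (f i) j \ between A f (f j) (f i) i with hD
  have hsub : between A f (f j) (f i) i ⊆ between A f (f j) (f i) j := by
    intro u hu
    simp only [between, Finset.mem_filter, Finset.mem_univ, true_and] at hu ⊢
    exact ⟨hu.1, hdom u hu.2⟩
  have hcard : (between A f (f j) (f i) j).card = (between A f (f j) (f i) i).card + D.card := by
    rw [hD, add_comm, Finset.card_sdiff_add_card_eq_card hsub]
  have hab : (before A f (f j) i).card ≤ (before A f (f j) j).card := by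
    refine Finset.card_le_card fun u hu => ?_
    simp only [before, Finset.mem_filter, Finset.mem_univ, true_and] at hu ⊢
    exact ⟨hu.1, hdom u hu.2⟩
  have hDmem : ∀ v ∈ D, (f j < f v ∧ f v < f i) ∧ A j v ∧ ¬ A i v := by
    intro v hv
    simp only [hD, between, Finset.mem_sdiff, Finset.mem_filter, Finset.mem_univ, true_and] at hv
    exact ⟨hv.1.1, hs _ _ hv.1.2, fun h => hv.2 ⟨hv.1.1, hs _ _ h⟩⟩
  have hDval : ∀ v ∈ D,
      ((earlier A (f ∘ Equiv.swap i j) v).card : ℝ) = (earlier A f v).card - 1 := by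
    intro v hv
    obtain ⟨⟨h1, h2⟩, h3, h4⟩ := hDmem v hv
    have := card_earlier_swap_of_between (A := A) h1 h2
    simp only [h3, h4, if_true, if_false, add_zero] at this
    rw [← this]
    push_cast
    ring
  have hother : ∀ v, v ≠ i → v ≠ j → v ∉ D →
      (earlier A (f ∘ Equiv.swap i j) v).card = (earlier A f v).card := by
    intro v hi hj hv
    by_cases hin : f j < f v ∧ f v < f i
    · have h := card_earlier_swap_of_between (A := A) hin.1 hin.2
      by_cases h3 : A j v
      · have h4 : A i v := by
          by_contra h4
          refine hv ?_
          simp only [hD, between, Finset.mem_sdiff, Finset.mem_filter, Finset.mem_univ, true_and]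
          exact ⟨⟨hin, hs _ _ h3⟩, fun h => h4 (hs _ _ h.2)⟩
        simpa [h3, h4] using h
      · have h4 : ¬ A i v := fun h4 => h3 (hs _ _ (hdom v (hs _ _ h4)))
        simpa [h3, h4] using h
    · have := hf.ne hi
      have := hf.ne hj
      rw [earlier_swap_of_outside hlt (by omega)]
  have hDsub : D ⊆ Finset.univ \ {i, j} := by
    intro v hv
    obtain ⟨⟨h1, h2⟩, -⟩ := hDmem v hv
    simp only [Finset.mem_sdiff, Finset.mem_univ, Finset.mem_insert, Finset.mem_singleton,
      true_and, not_or]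
    exact ⟨by rintro rfl; omega, by rintro rfl; omega⟩
  by_cases heq : (before A f (f j) i).card = (before A f (f j) j).card ∧ D = ∅
  · right
    obtain ⟨h1, h2⟩ := heq
    have : D.card = 0 := by rw [h2, Finset.card_empty]
    refine ⟨fun v hi hj => hother v hi hj (by simp [h2]), ?_, ?_, ?_⟩ <;> omega
  left
  set a : ℝ := (before A f (f j) i).card + 1 with ha
  set b : ℝ := (before A f (f j) j).card + 1 with hb
  set m : ℝ := ((between A f (f j) (f i) i).card : ℝ) with hm
  have ha0 : 0 < a := by positivity
  have hm0 : 0 ≤ m := by positivity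
  have hab' : a ≤ b := by rw [ha, hb]; gcongr
  obtain ⟨hle, hstrict⟩ := prod_sub_one_mul_le (D := D)
    (g := fun v => ((earlier A f v).card : ℝ)) (x := b + m + 1)
    (fun v _ => by exact_mod_cast card_earlier_pos hr v)
    (fun v hv => by
      have h := hmono v (hDmem v hv).1.2
      have h' : (earlier A f v).card ≤
          (before A f (f j) j).card + 1 + (between A f (f j) (f i) i).card + 1 := by omega
      rw [hb, hm]
      exact_mod_cast h') (by positivity)
  set Q := ∏ v ∈ D, ((earlier A f v).card : ℝ) with hQ
  set Q' := ∏ v ∈ D, (((earlier A f v).card : ℝ) - 1) with hQ'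
  set O := ∏ v ∈ (Finset.univ \ {i, j}) \ D, ((earlier A f v).card : ℝ) with hO
  have hQ0 : 0 < Q := Finset.prod_pos fun v _ => Nat.cast_pos.2 (card_earlier_pos hr v)
  have hO0 : 0 < O := Finset.prod_pos fun v _ => Nat.cast_pos.2 (card_earlier_pos hr v)
  have hP : ∏ v, ((earlier A f v).card : ℝ) = (a + m + 1) * b * (O * Q) := by
    rw [prod_split_pair hij, ← Finset.prod_sdiff hDsub, ei, ej]
    push_cast
    rw [← hO, ← hQ, ha, hb, hm]
    ring
  have hP' : ∏ v, ((earlier A (f ∘ Equiv.swap i j) v).card : ℝ) =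
      a * (b + m + 1 + D.card) * (O * Q') := by
    rw [prod_split_pair hij, ← Finset.prod_sdiff hDsub, ei', ej', hcard,
      Finset.prod_congr rfl hDval]
    have : ∏ v ∈ (Finset.univ \ {i, j}) \ D, ((earlier A (f ∘ Equiv.swap i j) v).card : ℝ) = O :=
      Finset.prod_congr rfl fun v hv => by
        simp only [Finset.mem_sdiff, Finset.mem_univ, Finset.mem_insert, Finset.mem_singleton,
          true_and, not_or] at hv
        rw [hother v hv.1.1 hv.1.2 hv.2]
    rw [this, ← hQ', ha, hb, hm]
    push_cast
    ring
  rw [hP, hP']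
  have key : a * (b + m + 1 + D.card) * Q' < (a + m + 1) * b * Q := by
    refine mul_lt_of_le_or_lt ha0 hab' hm0 hQ0 hle ?_
    rcases D.eq_empty_or_nonempty with hDe | hDn
    · refine Or.inl (add_lt_add_left (Nat.cast_lt.2 ?_) 1)
      exact lt_of_le_of_ne hab fun h => heq ⟨h, hDe⟩
    · exact Or.inr (hstrict hDn)
  calc a * (b + m + 1 + D.card) * (O * Q') = O * (a * (b + m + 1 + D.card) * Q') := by ring
    _ < O * ((a + m + 1) * b * Q) := mul_lt_mul_of_pos_left key hO0
    _ = (a + m + 1) * b * (O * Q) := by ring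

end ContactCount

/-- Some order minimizing the product of the contact set sizes places every element before
all strictly heavier elements that dominate it. -/
lemma exists_minimal_order_compatible {n : ℕ} {A : Fin n → Fin n → Prop} (w : Fin n → ℝ)
    (hr : ∀ v, A v v) (hs : ∀ u v, A u v → A v u) :
    ∃ σ : Equiv.Perm (Fin n),
      (∀ τ : Equiv.Perm (Fin n), ∏ v, ((earlier A (fun u => (σ u : ℕ)) v).card : ℝ) ≤
        ∏ v, ((earlier A (fun u => (τ u : ℕ)) v).card : ℝ)) ∧
      ∀ i j, (∀ u, A u i → A u j) → w i < w j → σ i < σ j := by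
  let G (τ : Equiv.Perm (Fin n)) (v : Fin n) : ℝ := (earlier A (fun u => (τ u : ℕ)) v).card
  let P (τ : Equiv.Perm (Fin n)) : ℝ := ∏ v, G τ v
  let W (τ : Equiv.Perm (Fin n)) : ℝ := ∑ v, G τ v * w v
  let S (τ : Equiv.Perm (Fin n)) : ℝ := ∑ v, G τ v * (τ v : ℕ)
  obtain ⟨σ, hσ⟩ := Finite.exists_min fun τ => toLex (P τ, toLex (-W τ, -S τ))
  have hP : ∀ τ, P σ ≤ P τ := fun τ => by
    rcases Prod.Lex.toLex_le_toLex.1 (hσ τ) with h | h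
    exacts [h.le, h.1.le]
  have hW : ∀ τ, P τ = P σ → W τ ≤ W σ := fun τ e => by
    rcases Prod.Lex.toLex_le_toLex.1 (hσ τ) with h | h
    · exact absurd h e.not_gt
    rcases Prod.Lex.toLex_le_toLex.1 h.2 with h | h
    exacts [(neg_lt_neg_iff.1 h).le, (neg_inj.1 h.1).ge]
  have hS : ∀ τ, P τ = P σ → W τ = W σ → S τ ≤ S σ := fun τ e e' => by
    rcases Prod.Lex.toLex_le_toLex.1 (hσ τ) with h | h
    · exact absurd h e.not_gt
    rcases Prod.Lex.toLex_le_toLex.1 h.2 with h | h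
    · exact absurd (neg_lt_neg_iff.1 h) e'.not_lt
    · exact neg_le_neg_iff.1 h.2
  set f : Fin n → ℕ := fun u => (σ u : ℕ) with hf
  have hinj : f.Injective := Fin.val_injective.comp σ.injective
  have hswap : ∀ i j, (fun u => (((Equiv.swap i j).trans σ) u : ℕ)) = f ∘ Equiv.swap i j :=
    fun i j => rfl
  have hcons : ∀ i j, f i = f j + 1 → (earlier A f j).card ≤ (earlier A f i).card := by
    intro i j hji
    by_contra! hlt
    have hij : i ≠ j := by rintro rfl; omega
    rcases swap_consecutive hr hs hinj hji hlt with h | h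
    · exact (hP ((Equiv.swap i j).trans σ)).not_gt h
    have hG : G ((Equiv.swap i j).trans σ) = G σ := funext fun v => by
      simp only [G, hswap, h]
      rfl
    refine (hS ((Equiv.swap i j).trans σ) (by simp only [P, hG]) (by simp only [W, hG])).not_gt ?_
    simp only [S, hG]
    rw [sum_split_pair hij, sum_split_pair hij (fun v => G σ v * (((Equiv.swap i j).trans σ) v : ℕ))]
    have ho : ∑ v ∈ Finset.univ \ {i, j}, G σ v * (((Equiv.swap i j).trans σ) v : ℕ) =
        ∑ v ∈ Finset.univ \ {i, j}, G σ v * (σ v : ℕ) := Finset.sum_congr rfl fun v hv => by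
      simp only [Finset.mem_sdiff, Finset.mem_univ, Finset.mem_insert, Finset.mem_singleton,
        true_and, not_or] at hv
      simp [Equiv.swap_apply_of_ne_of_ne hv.1 hv.2]
    rw [ho]
    have hlt' : G σ i < G σ j := Nat.cast_lt.2 hlt
    have hji' : ((σ i : ℕ) : ℝ) = (σ j : ℕ) + 1 := by exact_mod_cast hji
    simp only [Equiv.trans_apply, Equiv.swap_apply_left, Equiv.swap_apply_right, hji']
    nlinarith
  have hmono : ∀ i j, f j < f i → (earlier A f j).card ≤ (earlier A f i).card := by
    have hm : Monotone fun p : Fin n => (earlier A f (σ.symm p)).card := by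
      cases n with
      | zero => exact fun p => p.elim0
      | succ n =>
        exact Fin.monotone_iff_le_succ.2 fun p => hcons _ _ (by simp [hf])
    intro i j h
    simpa using hm (show σ j ≤ σ i from Fin.le_def.2 h.le)
  refine ⟨σ, hP, fun i j hdom hw => ?_⟩
  by_contra! hji
  have hij : i ≠ j := by rintro rfl; exact hw.false
  have hlt : f j < f i := lt_of_le_of_ne hji (hinj.ne hij.symm)
  rcases swap_dominated hr hs hinj hlt hdom (fun v hv => hmono i v hv) with h | ⟨ho, hi, hj, hG⟩
  · exact (hP ((Equiv.swap i j).trans σ)).not_gt h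
  have hi' : G ((Equiv.swap i j).trans σ) i = G σ j := by simp only [G, hswap, hi]; rfl
  have hj' : G ((Equiv.swap i j).trans σ) j = G σ i := by simp only [G, hswap, hj]; rfl
  have ho' : ∀ v ∈ Finset.univ \ {i, j}, G ((Equiv.swap i j).trans σ) v = G σ v := by
    intro v hv
    simp only [Finset.mem_sdiff, Finset.mem_univ, Finset.mem_insert, Finset.mem_singleton,
      true_and, not_or] at hv
    simp only [G, hswap, ho v hv.1 hv.2]
    rfl
  refine (hW ((Equiv.swap i j).trans σ) ?_).not_gt ?_
  · simp only [P]
    rw [prod_split_pair hij, prod_split_pair hij (G σ), Finset.prod_congr rfl ho', hi', hj',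
      mul_comm (G σ j)]
  · simp only [W]
    rw [sum_split_pair hij,
      sum_split_pair hij (fun v => G ((Equiv.swap i j).trans σ) v * w v), hi', hj',
      Finset.sum_congr rfl fun v hv => congrArg (· * w v) (ho' v hv)]
    have hG' : G σ j < G σ i := Nat.cast_lt.2 hG
    nlinarith

lemma piAmbiguity_comp_perm {n : ℕ} {l r : Fin n → ℝ} (hlr : ∀ i, l i < r i)
    (π : Equiv.Perm (Fin n)) :
    piAmbiguity n (l ∘ π) (r ∘ π) = Real.logb 2 (∏ v, ((earlier
      (fun u v => (Set.Ioo (l u) (r u) ∩ Set.Ioo (l v) (r v)).Nonempty)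
      (fun u => (π.symm u : ℕ)) v).card : ℝ)) := by
  rw [Real.logb_prod _ _ fun v _ => ?_, piAmbiguity]
  · refine Eq.trans ?_ (Equiv.sum_comp π _)
    refine Finset.sum_congr rfl fun i _ => ?_
    congr 2
    refine Finset.card_bij (fun j _ => π j) ?_ (fun _ _ _ _ h => π.injective h) ?_
    · intro j hj
      simpa [contact, earlier] using hj
    · intro u hu
      exact ⟨π.symm u, by simpa [contact, earlier] using hu, by simp⟩
  · exact Nat.cast_ne_zero.2 (card_earlier_pos (fun v => by simpa using hlr v) v).ne'

theorem stmt10 (n : ℕ) (hn : 1 ≤ n) (l r : Fin n → ℝ) (hlr : ∀ i, l i < r i) :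
    ∃ π : Equiv.Perm (Fin n),
      ContainmentCompatible n (l ∘ π) (r ∘ π) ∧
      piAmbiguity n (l ∘ π) (r ∘ π) = ambiguity n l r := by
  have hr : ∀ v, (Set.Ioo (l v) (r v) ∩ Set.Ioo (l v) (r v)).Nonempty :=
    fun v => by simpa using hlr v
  obtain ⟨σ, hmin, hcompat⟩ := exists_minimal_order_compatible
    (A := fun u v => (Set.Ioo (l u) (r u) ∩ Set.Ioo (l v) (r v)).Nonempty)
    (fun v => r v - l v) hr (fun u v h => by rwa [Set.inter_comm])
  refine ⟨σ.symm, fun i j hij => ?_, le_antisymm (le_ciInf fun τ => ?_)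
    (ciInf_le (Set.finite_range _).bddBelow σ.symm)⟩
  · have h := hcompat (σ.symm i) (σ.symm j)
      (fun u hu => hu.mono (Set.inter_subset_inter_right _ hij.subset)) ?_
    · simpa using h
    · obtain ⟨h1, h2⟩ := (Set.Ioo_subset_Ioo_iff (hlr (σ.symm i))).1 hij.subset
      simp only [Function.comp_apply] at h1 h2
      refine lt_of_le_of_ne (by linarith) fun h => hij.ne ?_
      have e1 : l (σ.symm i) = l (σ.symm j) := by linarith
      have e2 : r (σ.symm i) = r (σ.symm j) := by linarith
      simp [e1, e2]
  · rw [piAmbiguity_comp_perm hlr, piAmbiguity_comp_perm hlr, Equiv.symm_symm]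
    refine Real.logb_le_logb_of_le one_lt_two
      (Finset.prod_pos fun v _ => Nat.cast_pos.2 (card_earlier_pos hr v)) (hmin τ.symm)
end

section
/- For any containment-compatible processing order π of the family R, log₂ e(R) ≤ 3·A^π(R), where e(R) is the number of linear extensions of the interval order induced by R. (This is the information-theoretic content of the lower bound that reconstructing a sorted order on points x_i ∈ R_i requires Ω(A(R)) comparisons.) -/
open scoped Classical

/-- Indices of the contact set of `R_i`, other than `i`, that `σ` ranks below `i`. -/
noncomputable def contactBelow (n : ℕ) (l r : Fin n → ℝ) (σ : Equiv.Perm (Fin n)) (i : Fin n) :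
    Finset (Fin n) :=
  (contact n l r i).filter (fun j => j < i ∧ σ j < σ i)

theorem card_contactBelow_lt {n : ℕ} {l r : Fin n → ℝ} (hlr : ∀ i, l i < r i)
    (σ : Equiv.Perm (Fin n)) (i : Fin n) :
    (contactBelow n l r σ i).card < (contact n l r i).card := by
  refine Finset.card_lt_card (Finset.ssubset_iff_subset_ne.2 ⟨Finset.filter_subset _ _, ?_⟩)
  intro h
  have hi := self_mem_contact hlr i
  rw [← h] at hi
  simp [contactBelow] at hi

theorem le_or_le_of_notMem_contact {n : ℕ} {l r : Fin n → ℝ} (hlr : ∀ i, l i < r i)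
    {i j : Fin n} (hji : j ≤ i) (h : j ∉ contact n l r i) : r j ≤ l i ∨ r i ≤ l j := by
  by_contra! hc
  apply h
  simp [contact, Set.Ioo_inter_Ioo, hji, hlr, hc.1, hc.2]

theorem perm_eq_of_lt_iff_lt {n : ℕ} {σ τ : Equiv.Perm (Fin n)}
    (h : ∀ i j, σ i < σ j ↔ τ i < τ j) : σ = τ := by
  let e : Fin n ≃o Fin n :=
    { toEquiv := σ.symm.trans τ
      map_rel_iff' := by
        intro a b
        have := h (σ.symm b) (σ.symm a)
        simp only [Equiv.apply_symm_apply] at this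
        simpa using not_congr this.symm }
  have he : e = OrderIso.refl _ := Subsingleton.elim _ _
  ext i
  have hi : e (σ i) = σ i := by rw [he]; rfl
  have hτ : e (σ i) = τ i := by simp [e]
  rw [← hi, hτ]

/-- Two sets which are initial segments of a set totally preordered by `f` are nested. -/
theorem subset_or_subset_of_initial {α β : Type*} [LinearOrder β] {s t : Finset α} {f : α → β}
    (hs : ∀ a ∈ s, ∀ b ∈ t, f b ≤ f a → b ∈ s) (ht : ∀ b ∈ t, ∀ a ∈ s, f a ≤ f b → a ∈ t) :
    s ⊆ t ∨ t ⊆ s := by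
  by_contra! hc
  obtain ⟨a, ha, hat⟩ := Finset.not_subset.1 hc.1
  obtain ⟨b, hb, hbs⟩ := Finset.not_subset.1 hc.2
  rcases le_total (f b) (f a) with h | h
  · exact hbs (hs a ha b hb h)
  · exact hat (ht b hb a ha h)

theorem contactBelow_eq {n : ℕ} {l r : Fin n → ℝ} {σ τ : Equiv.Perm (Fin n)} {i : Fin n}
    (hlt : ∀ j < i, ∀ k < i, (σ j < σ k ↔ τ j < τ k))
    (hcard : (contactBelow n l r σ i).card = (contactBelow n l r τ i).card) :
    contactBelow n l r σ i = contactBelow n l r τ i := by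
  have key : contactBelow n l r σ i ⊆ contactBelow n l r τ i ∨
      contactBelow n l r τ i ⊆ contactBelow n l r σ i := by
    refine subset_or_subset_of_initial (f := σ) ?_ ?_
    · intro a ha b hb hab
      simp only [contactBelow, Finset.mem_filter] at ha hb ⊢
      exact ⟨hb.1, hb.2.1, hab.trans_lt ha.2.2⟩
    · intro b hb a ha hab
      simp only [contactBelow, Finset.mem_filter] at ha hb ⊢
      have hab' : τ a ≤ τ b := not_lt.1 fun h =>
        not_lt.2 hab ((hlt b hb.2.1 a ha.2.1).2 h)
      exact ⟨ha.1, ha.2.1, hab'.trans_lt hb.2.2⟩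
  rcases key with h | h
  · exact Finset.eq_of_subset_of_card_le h hcard.ge
  · exact (Finset.eq_of_subset_of_card_le h hcard.le).symm

theorem lt_iff_lt_swap {n : ℕ} {σ τ : Equiv.Perm (Fin n)} {j k : Fin n} (hjk : j ≠ k)
    (h : σ j < σ k ↔ τ j < τ k) : σ k < σ j ↔ τ k < τ j := by
  rw [← not_iff_not, not_lt, not_lt, (σ.injective.ne hjk).le_iff_lt,
    (τ.injective.ne hjk).le_iff_lt]
  exact h

/-- A linear extension is determined by its insertion ranks within the contact sets. -/
theorem linExt_eq_of_card_contactBelow_eq {n : ℕ} {l r : Fin n → ℝ} (hlr : ∀ i, l i < r i)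
    {σ τ : Equiv.Perm (Fin n)} (hσ : ∀ i j, r i ≤ l j → σ i < σ j)
    (hτ : ∀ i j, r i ≤ l j → τ i < τ j)
    (hcard : ∀ i, (contactBelow n l r σ i).card = (contactBelow n l r τ i).card) : σ = τ := by
  have key : ∀ i, ∀ j < i, (σ j < σ i ↔ τ j < τ i) := by
    intro i
    induction i using WellFoundedLT.induction with
    | ind i ih =>
    have hlt : ∀ j < i, ∀ k < i, (σ j < σ k ↔ τ j < τ k) := by
      intro j hj k hk
      rcases lt_trichotomy j k with h | rfl | h
      · exact ih k hk j h
      · simp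
      · exact lt_iff_lt_swap h.ne (ih j hj k h)
    have heq := contactBelow_eq hlt (hcard i)
    intro j hj
    by_cases hmem : j ∈ contact n l r i
    · have := Finset.ext_iff.1 heq j
      simpa [contactBelow, hmem, hj] using this
    · rcases le_or_le_of_notMem_contact hlr hj.le hmem with h | h
      · exact iff_of_true (hσ _ _ h) (hτ _ _ h)
      · exact iff_of_false (hσ _ _ h).not_gt (hτ _ _ h).not_gt
  apply perm_eq_of_lt_iff_lt
  intro j i
  rcases lt_trichotomy j i with h | rfl | h
  · exact key i j h
  · simp
  · exact lt_iff_lt_swap h.ne (key j i h)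

theorem numLinExt_le_prod_card_contact {n : ℕ} {l r : Fin n → ℝ} (hlr : ∀ i, l i < r i) :
    numLinExt n l r ≤ ∏ i, (contact n l r i).card := by
  let f : {σ : Equiv.Perm (Fin n) // ∀ i j : Fin n, r i ≤ l j → σ i < σ j} →
      ((i : Fin n) → Fin (contact n l r i).card) :=
    fun σ i => ⟨(contactBelow n l r σ.1 i).card, card_contactBelow_lt hlr σ.1 i⟩
  have hf : Function.Injective f := by
    intro σ τ h
    exact Subtype.ext (linExt_eq_of_card_contactBelow_eq hlr σ.2 τ.2
      fun i => congrArg Fin.val (congrFun h i))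
  simpa [numLinExt] using Fintype.card_le_of_injective f hf

theorem numLinExt_comp_perm (n : ℕ) (l r : Fin n → ℝ) (π : Equiv.Perm (Fin n)) :
    numLinExt n (l ∘ π) (r ∘ π) = numLinExt n l r := by
  unfold numLinExt
  refine Fintype.card_congr
    ((Equiv.equivCongr π (Equiv.refl (Fin n))).subtypeEquiv fun σ => ?_)
  constructor
  · intro h i j hij
    exact h (π.symm i) (π.symm j) (by simpa using hij)
  · intro h i j hij
    simpa using h (π i) (π j) hij

theorem logb_numLinExt_le_piAmbiguity {n : ℕ} {l r : Fin n → ℝ} (hlr : ∀ i, l i < r i) :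
    Real.logb 2 (numLinExt n l r : ℝ) ≤ piAmbiguity n l r := by
  have hpos : ∀ i, 0 < (contact n l r i).card := fun i =>
    Finset.card_pos.2 ⟨i, self_mem_contact hlr i⟩
  have hprod : Real.logb 2 (∏ i, ((contact n l r i).card : ℝ)) = piAmbiguity n l r :=
    Real.logb_prod _ _ fun i _ => by exact_mod_cast (hpos i).ne'
  rw [← hprod]
  rcases Nat.eq_zero_or_pos (numLinExt n l r) with h | h
  · rw [h, Nat.cast_zero, Real.logb_zero]
    refine Real.logb_nonneg one_lt_two ?_
    exact_mod_cast Nat.one_le_iff_ne_zero.2 (Finset.prod_ne_zero_iff.2 fun i _ => (hpos i).ne')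
  · refine Real.logb_le_logb_of_le one_lt_two (by exact_mod_cast h) ?_
    exact_mod_cast numLinExt_le_prod_card_contact hlr

theorem piAmbiguity_nonneg (n : ℕ) (l r : Fin n → ℝ) : 0 ≤ piAmbiguity n l r := by
  refine Finset.sum_nonneg fun i _ => ?_
  rcases Nat.eq_zero_or_pos (contact n l r i).card with h | h
  · simp [h]
  · exact Real.logb_nonneg one_lt_two (by exact_mod_cast h)

theorem stmt11 (n : ℕ) (hn : 1 ≤ n) (l r : Fin n → ℝ) (hlr : ∀ i, l i < r i)
    (π : Equiv.Perm (Fin n))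
    (hcc : ContainmentCompatible n (l ∘ π) (r ∘ π)) :
    Real.logb 2 ((numLinExt n l r : ℝ)) ≤ 3 * piAmbiguity n (l ∘ π) (r ∘ π) := by
  have h := logb_numLinExt_le_piAmbiguity (l := l ∘ π) (r := r ∘ π) fun i => hlr (π i)
  rw [numLinExt_comp_perm] at h
  linarith [piAmbiguity_nonneg n (l ∘ π) (r ∘ π)]
end
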